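/- arXiv:math/0607706 — 2 statements merged into one kernel-verified Lean document; each statement's English description precedes it below -/
import Mathlib

section
/- Let Ω' ⊆ ℝ^{n'} and Ω ⊆ ℝ^n be open and let (b_ε)_{ε∈(0,1]} be a net of smooth functions on Ω'×Ω×ℝ^p whose supports in the y-variable are contained in a fixed compact set K ⊆ Ω for all ε. If (b_ε) is a moderate net of order −∞, then v_ε(x) := ∫_{K×ℝ^p} b_ε(x,y,ξ) dy d̄ξ is absolutely convergent, each v_ε is smooth on Ω', and the net (v_ε)_ε belongs to E_M(Ω'). If (b_ε) is a regular net of order −∞, then (v_ε)_ε belongs to E^∞_M(Ω'). -/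
open MeasureTheory Set
open scoped BigOperators Topology Real

noncomputable section

/-- `Euc d` is `d`-dimensional Euclidean space. -/
abbrev Euc (d : ℕ) : Type := EuclideanSpace ℝ (Fin d)

/-- Directional derivative of `f` in direction `v`. -/
def dirD {E F : Type*} [NormedAddCommGroup E] [NormedSpace ℝ E]
    [NormedAddCommGroup F] [NormedSpace ℝ F] (v : E) (f : E → F) : E → F :=
  fun x => fderiv ℝ f x v

/-- Iterated directional derivatives along a list of directions. -/
def dirDs {E F : Type*} [NormedAddCommGroup E] [NormedSpace ℝ E]
    [NormedAddCommGroup F] [NormedSpace ℝ F] (L : List E) (f : E → F) : E → F :=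
  L.foldr dirD f

/-- ⟨ξ⟩ = (1+|ξ|²)^{1/2}. -/
def jb {d : ℕ} (ξ : Euc d) : ℝ := Real.sqrt (1 + ‖ξ‖ ^ 2)

/-- Basis direction in the first (`y`) block. -/
def eY {n p : ℕ} (k : Fin n) : Euc n × Euc p := (EuclideanSpace.single k 1, 0)

/-- Basis direction in the second (`ξ`) block. -/
def eXi {n p : ℕ} (j : Fin p) : Euc n × Euc p := (0, EuclideanSpace.single j 1)

def eX3 {q n p : ℕ} (i : Fin q) : Euc q × Euc n × Euc p := (EuclideanSpace.single i 1, 0, 0)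
def eY3 {q n p : ℕ} (k : Fin n) : Euc q × Euc n × Euc p := (0, EuclideanSpace.single k 1, 0)
def eXi3 {q n p : ℕ} (j : Fin p) : Euc q × Euc n × Euc p := (0, 0, EuclideanSpace.single j 1)

/-- basis directions of `Euc d` indexed by a list of coordinates -/
def basisL {d : ℕ} (L : List (Fin d)) : List (Euc d) :=
  L.map (fun i => EuclideanSpace.single i 1)

/-- |∇_{y,ξ}φ|² as a sum of squares of partial derivatives. -/
def gradSq {n p : ℕ} (φ : Euc n × Euc p → ℝ) (z : Euc n × Euc p) : ℝ :=
  (∑ k : Fin n, (dirD (eY k) φ z) ^ 2) + ∑ j : Fin p, (dirD (eXi j) φ z) ^ 2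

/-- |∇_ξ φ|². -/
def gradXiSq {n p : ℕ} (φ : Euc n × Euc p → ℝ) (z : Euc n × Euc p) : ℝ :=
  ∑ j : Fin p, (dirD (eXi j) φ z) ^ 2

/-- ∇_y φ as a vector in `Euc n`. -/
def gradY {n p : ℕ} (φ : Euc n × Euc p → ℝ) (z : Euc n × Euc p) : Euc n :=
  (EuclideanSpace.equiv (Fin n) ℝ).symm (fun k => dirD (eY k) φ z)

/-- |∇_{y,ξ}φ|² in the three-block setting (gradient w.r.t. `(y,ξ)` only). -/
def gradSq3 {q n p : ℕ} (φ : Euc q × Euc n × Euc p → ℝ) (z : Euc q × Euc n × Euc p) : ℝ :=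
  (∑ k : Fin n, (dirD (eY3 k) φ z) ^ 2) + ∑ j : Fin p, (dirD (eXi3 j) φ z) ^ 2

/-- slow scale net -/
def SlowScale (s : ℝ → ℝ) : Prop :=
  (∀ ε ∈ Set.Ioc (0:ℝ) 1, 0 < s ε) ∧
  ∀ q : ℕ, ∃ c > 0, ∀ ε ∈ Set.Ioc (0:ℝ) 1, s ε ^ q ≤ c / ε

/-- Moderate net in S^m_{ρ,δ}(Ω×ℝ^p): smoothness, membership, moderate bounds. -/
def SymbModerate {n p : ℕ} (Ω : Set (Euc n)) (m ρ δ : ℝ)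
    (a : ℝ → Euc n × Euc p → ℂ) : Prop :=
  (∀ ε ∈ Set.Ioc (0:ℝ) 1, ContDiffOn ℝ (⊤ : ℕ∞) (a ε) (Ω ×ˢ (univ : Set (Euc p)))) ∧
  (∀ ε ∈ Set.Ioc (0:ℝ) 1, ∀ K ⊆ Ω, IsCompact K → ∀ (α : List (Fin p)) (β : List (Fin n)),
    ∃ C : ℝ, ∀ y ∈ K, ∀ ξ : Euc p,
      jb ξ ^ (-m + ρ * (α.length : ℝ) - δ * (β.length : ℝ)) *
        ‖dirDs (α.map eXi ++ β.map eY) (a ε) (y, ξ)‖ ≤ C) ∧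
  ∀ K ⊆ Ω, IsCompact K → ∀ (α : List (Fin p)) (β : List (Fin n)),
    ∃ N : ℕ, ∃ C > 0, ∃ η ∈ Set.Ioc (0:ℝ) 1, ∀ ε ∈ Set.Ioc (0:ℝ) η, ∀ y ∈ K, ∀ ξ : Euc p,
      jb ξ ^ (-m + ρ * (α.length : ℝ) - δ * (β.length : ℝ)) *
        ‖dirDs (α.map eXi ++ β.map eY) (a ε) (y, ξ)‖ ≤ C * ε ^ (-(N : ℤ))

/-- Negligible net in S^m_{ρ,δ}(Ω×ℝ^p). -/
def SymbNegligible {n p : ℕ} (Ω : Set (Euc n)) (m ρ δ : ℝ)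
    (a : ℝ → Euc n × Euc p → ℂ) : Prop :=
  (∀ ε ∈ Set.Ioc (0:ℝ) 1, ContDiffOn ℝ (⊤ : ℕ∞) (a ε) (Ω ×ˢ (univ : Set (Euc p)))) ∧
  (∀ ε ∈ Set.Ioc (0:ℝ) 1, ∀ K ⊆ Ω, IsCompact K → ∀ (α : List (Fin p)) (β : List (Fin n)),
    ∃ C : ℝ, ∀ y ∈ K, ∀ ξ : Euc p,
      jb ξ ^ (-m + ρ * (α.length : ℝ) - δ * (β.length : ℝ)) *
        ‖dirDs (α.map eXi ++ β.map eY) (a ε) (y, ξ)‖ ≤ C) ∧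
  ∀ K ⊆ Ω, IsCompact K → ∀ (α : List (Fin p)) (β : List (Fin n)), ∀ q : ℕ,
    ∃ C > 0, ∃ η ∈ Set.Ioc (0:ℝ) 1, ∀ ε ∈ Set.Ioc (0:ℝ) η, ∀ y ∈ K, ∀ ξ : Euc p,
      jb ξ ^ (-m + ρ * (α.length : ℝ) - δ * (β.length : ℝ)) *
        ‖dirDs (α.map eXi ++ β.map eY) (a ε) (y, ξ)‖ ≤ C * ε ^ q

/-- Regular net in S^m_{ρ,δ}(Ω×ℝ^p): one N works for all derivatives on each compact set. -/
def SymbRegular {n p : ℕ} (Ω : Set (Euc n)) (m ρ δ : ℝ)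
    (a : ℝ → Euc n × Euc p → ℂ) : Prop :=
  (∀ ε ∈ Set.Ioc (0:ℝ) 1, ContDiffOn ℝ (⊤ : ℕ∞) (a ε) (Ω ×ˢ (univ : Set (Euc p)))) ∧
  (∀ ε ∈ Set.Ioc (0:ℝ) 1, ∀ K ⊆ Ω, IsCompact K → ∀ (α : List (Fin p)) (β : List (Fin n)),
    ∃ C : ℝ, ∀ y ∈ K, ∀ ξ : Euc p,
      jb ξ ^ (-m + ρ * (α.length : ℝ) - δ * (β.length : ℝ)) *
        ‖dirDs (α.map eXi ++ β.map eY) (a ε) (y, ξ)‖ ≤ C) ∧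
  ∀ K ⊆ Ω, IsCompact K → ∃ N : ℕ, ∀ (α : List (Fin p)) (β : List (Fin n)),
    ∃ C > 0, ∃ η ∈ Set.Ioc (0:ℝ) 1, ∀ ε ∈ Set.Ioc (0:ℝ) η, ∀ y ∈ K, ∀ ξ : Euc p,
      jb ξ ^ (-m + ρ * (α.length : ℝ) - δ * (β.length : ℝ)) *
        ‖dirDs (α.map eXi ++ β.map eY) (a ε) (y, ξ)‖ ≤ C * ε ^ (-(N : ℤ))

/-- Moderate net in S^m_hg(Ω×ℝ^p∖0) (F-valued, positively homogeneous symbols). -/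
def HgModerate {n p : ℕ} {F : Type*} [NormedAddCommGroup F] [NormedSpace ℝ F]
    (Ω : Set (Euc n)) (m : ℝ) (φ : ℝ → Euc n × Euc p → F) : Prop :=
  ∀ K ⊆ Ω, IsCompact K → ∀ (α : List (Fin p)) (β : List (Fin n)),
    ∃ N : ℕ, ∃ C > 0, ∃ η ∈ Set.Ioc (0:ℝ) 1, ∀ ε ∈ Set.Ioc (0:ℝ) η, ∀ y ∈ K,
      ∀ ξ : Euc p, ξ ≠ 0 →
      ‖ξ‖ ^ (-m + (α.length : ℝ)) *
        ‖dirDs (α.map eXi ++ β.map eY) (φ ε) (y, ξ)‖ ≤ C * ε ^ (-(N : ℤ))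

/-- Negligible net in S^m_hg(Ω×ℝ^p∖0). -/
def HgNegligible {n p : ℕ} {F : Type*} [NormedAddCommGroup F] [NormedSpace ℝ F]
    (Ω : Set (Euc n)) (m : ℝ) (φ : ℝ → Euc n × Euc p → F) : Prop :=
  ∀ K ⊆ Ω, IsCompact K → ∀ (α : List (Fin p)) (β : List (Fin n)), ∀ q : ℕ,
    ∃ C > 0, ∃ η ∈ Set.Ioc (0:ℝ) 1, ∀ ε ∈ Set.Ioc (0:ℝ) η, ∀ y ∈ K,
      ∀ ξ : Euc p, ξ ≠ 0 →
      ‖ξ‖ ^ (-m + (α.length : ℝ)) *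
        ‖dirDs (α.map eXi ++ β.map eY) (φ ε) (y, ξ)‖ ≤ C * ε ^ q

/-- Net of phase functions on Ω×ℝ^p. -/
def IsPhaseNet {n p : ℕ} (Ω : Set (Euc n)) (φ : ℝ → Euc n × Euc p → ℝ) : Prop :=
  ∀ ε ∈ Set.Ioc (0:ℝ) 1,
    ContDiffOn ℝ (⊤ : ℕ∞) (φ ε) (Ω ×ˢ {ξ : Euc p | ξ ≠ 0}) ∧
    (∀ y ∈ Ω, ∀ ξ : Euc p, ξ ≠ 0 → ∀ t : ℝ, 0 < t → φ ε (y, t • ξ) = t * φ ε (y, ξ)) ∧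
    (∀ y ∈ Ω, ∀ ξ : Euc p, ξ ≠ 0 → gradSq (φ ε) (y, ξ) ≠ 0)

/-- The set M_Φ(Ω×ℝ^p) of moderate nets of phase functions with strictly nonzero gradient. -/
def MPhi {n p : ℕ} (Ω : Set (Euc n)) (φ : ℝ → Euc n × Euc p → ℝ) : Prop :=
  IsPhaseNet Ω φ ∧ HgModerate Ω 1 φ ∧
  ∀ K ⊆ Ω, IsCompact K → ∃ r > (0:ℝ), ∃ η ∈ Set.Ioc (0:ℝ) 1, ∀ ε ∈ Set.Ioc (0:ℝ) η,
    ∀ y ∈ K, ∀ ξ : Euc p, ξ ≠ 0 → ε ^ r ≤ gradSq (φ ε) (y, ‖ξ‖⁻¹ • ξ)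

/-- Slow scale moderateness in S^m_hg. -/
def HgSlowScale {n p : ℕ} {F : Type*} [NormedAddCommGroup F] [NormedSpace ℝ F]
    (Ω : Set (Euc n)) (m : ℝ) (φ : ℝ → Euc n × Euc p → F) : Prop :=
  ∀ K ⊆ Ω, IsCompact K → ∀ (α : List (Fin p)) (β : List (Fin n)),
    ∃ s : ℝ → ℝ, SlowScale s ∧ ∃ η ∈ Set.Ioc (0:ℝ) 1, ∀ ε ∈ Set.Ioc (0:ℝ) η, ∀ y ∈ K,
      ∀ ξ : Euc p, ξ ≠ 0 →
      ‖ξ‖ ^ (-m + (α.length : ℝ)) *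
        ‖dirDs (α.map eXi ++ β.map eY) (φ ε) (y, ξ)‖ ≤ s ε

/-- Slow scale nets of phase functions M_{Φ,sc}(Ω×ℝ^p). -/
def MPhiSc {n p : ℕ} (Ω : Set (Euc n)) (φ : ℝ → Euc n × Euc p → ℝ) : Prop :=
  IsPhaseNet Ω φ ∧ HgSlowScale Ω 1 φ ∧
  ∀ K ⊆ Ω, IsCompact K → ∃ s : ℝ → ℝ, SlowScale s ∧ ∃ η ∈ Set.Ioc (0:ℝ) 1,
    ∀ ε ∈ Set.Ioc (0:ℝ) η, ∀ y ∈ K, ∀ ξ : Euc p, ξ ≠ 0 →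
      (s ε)⁻¹ ≤ gradSq (φ ε) (y, ‖ξ‖⁻¹ • ξ)

/-- cut-off function equal to 1 for |ξ|<1/4 and 0 for |ξ|>1/2. -/
def IsCutoff {p : ℕ} (χ : Euc p → ℝ) : Prop :=
  ContDiff ℝ (⊤ : ℕ∞) χ ∧ (∀ ξ : Euc p, ‖ξ‖ < 1/4 → χ ξ = 1) ∧ (∀ ξ : Euc p, 1/2 < ‖ξ‖ → χ ξ = 0)

/-- 1/|∇_{y,ξ}φ(y,ξ/|ξ|)|². -/
def varphiN {n p : ℕ} (φ : Euc n × Euc p → ℝ) (z : Euc n × Euc p) : ℝ :=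
  (gradSq φ (z.1, ‖z.2‖⁻¹ • z.2))⁻¹

def coefA {n p : ℕ} (χ : Euc p → ℝ) (φ : Euc n × Euc p → ℝ) (j : Fin p) :
    Euc n × Euc p → ℂ :=
  fun z => Complex.I * (((1 - χ z.2) * varphiN φ z * dirD (eXi j) φ z : ℝ) : ℂ)

def coefB {n p : ℕ} (χ : Euc p → ℝ) (φ : Euc n × Euc p → ℝ) (k : Fin n) :
    Euc n × Euc p → ℂ :=
  fun z => Complex.I * (((1 - χ z.2) * (‖z.2‖ ^ 2)⁻¹ * varphiN φ z * dirD (eY k) φ z : ℝ) : ℂ)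

def coefC {n p : ℕ} (χ : Euc p → ℝ) (φ : Euc n × Euc p → ℝ) : Euc n × Euc p → ℂ :=
  fun z => ((χ z.2 : ℝ) : ℂ) + (∑ j : Fin p, dirD (eXi j) (coefA χ φ j) z)
    + ∑ k : Fin n, dirD (eY k) (coefB χ φ k) z

/-- The operator L_φ. -/
def Lop {n p : ℕ} (χ : Euc p → ℝ) (φ : Euc n × Euc p → ℝ) (f : Euc n × Euc p → ℂ) :
    Euc n × Euc p → ℂ :=
  fun z => (∑ j : Fin p, coefA χ φ j z * dirD (eXi j) f z)
    + (∑ k : Fin n, coefB χ φ k z * dirD (eY k) f z) + coefC χ φ z * f z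

/-- Moderate nets of smooth functions E_M(Ω). -/
def EMod {d : ℕ} (Ω : Set (Euc d)) (v : ℝ → Euc d → ℂ) : Prop :=
  (∀ ε ∈ Set.Ioc (0:ℝ) 1, ContDiffOn ℝ (⊤ : ℕ∞) (v ε) Ω) ∧
  ∀ K ⊆ Ω, IsCompact K → ∀ L : List (Fin d),
    ∃ N : ℕ, ∃ C > 0, ∃ η ∈ Set.Ioc (0:ℝ) 1, ∀ ε ∈ Set.Ioc (0:ℝ) η, ∀ x ∈ K,
      ‖dirDs (basisL L) (v ε) x‖ ≤ C * ε ^ (-(N : ℤ))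

/-- Regular nets of smooth functions E^∞_M(Ω). -/
def EModInf {d : ℕ} (Ω : Set (Euc d)) (v : ℝ → Euc d → ℂ) : Prop :=
  (∀ ε ∈ Set.Ioc (0:ℝ) 1, ContDiffOn ℝ (⊤ : ℕ∞) (v ε) Ω) ∧
  ∀ K ⊆ Ω, IsCompact K → ∃ N : ℕ, ∀ L : List (Fin d),
    ∃ C > 0, ∃ η ∈ Set.Ioc (0:ℝ) 1, ∀ ε ∈ Set.Ioc (0:ℝ) η, ∀ x ∈ K,
      ‖dirDs (basisL L) (v ε) x‖ ≤ C * ε ^ (-(N : ℤ))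

/-- Moderate net in S^m_{ρ,δ}(Ω'×Ω×ℝ^p). -/
def Symb3Moderate {q n p : ℕ} (Ω' : Set (Euc q)) (Ω : Set (Euc n)) (m ρ δ : ℝ)
    (a : ℝ → Euc q × Euc n × Euc p → ℂ) : Prop :=
  (∀ ε ∈ Set.Ioc (0:ℝ) 1, ContDiffOn ℝ (⊤ : ℕ∞) (a ε) (Ω' ×ˢ Ω ×ˢ (univ : Set (Euc p)))) ∧
  (∀ ε ∈ Set.Ioc (0:ℝ) 1, ∀ K' ⊆ Ω', IsCompact K' → ∀ K ⊆ Ω, IsCompact K →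
    ∀ (α : List (Fin p)) (βx : List (Fin q)) (βy : List (Fin n)),
    ∃ C : ℝ, ∀ x ∈ K', ∀ y ∈ K, ∀ ξ : Euc p,
      jb ξ ^ (-m + ρ * (α.length : ℝ) - δ * ((βx.length + βy.length : ℕ) : ℝ)) *
        ‖dirDs (α.map eXi3 ++ βx.map eX3 ++ βy.map eY3) (a ε) (x, y, ξ)‖ ≤ C) ∧
  ∀ K' ⊆ Ω', IsCompact K' → ∀ K ⊆ Ω, IsCompact K →
    ∀ (α : List (Fin p)) (βx : List (Fin q)) (βy : List (Fin n)),
    ∃ N : ℕ, ∃ C > 0, ∃ η ∈ Set.Ioc (0:ℝ) 1, ∀ ε ∈ Set.Ioc (0:ℝ) η,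
      ∀ x ∈ K', ∀ y ∈ K, ∀ ξ : Euc p,
      jb ξ ^ (-m + ρ * (α.length : ℝ) - δ * ((βx.length + βy.length : ℕ) : ℝ)) *
        ‖dirDs (α.map eXi3 ++ βx.map eX3 ++ βy.map eY3) (a ε) (x, y, ξ)‖ ≤ C * ε ^ (-(N : ℤ))

/-- Regular net in S^m_{ρ,δ}(Ω'×Ω×ℝ^p). -/
def Symb3Regular {q n p : ℕ} (Ω' : Set (Euc q)) (Ω : Set (Euc n)) (m ρ δ : ℝ)
    (a : ℝ → Euc q × Euc n × Euc p → ℂ) : Prop :=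
  (∀ ε ∈ Set.Ioc (0:ℝ) 1, ContDiffOn ℝ (⊤ : ℕ∞) (a ε) (Ω' ×ˢ Ω ×ˢ (univ : Set (Euc p)))) ∧
  (∀ ε ∈ Set.Ioc (0:ℝ) 1, ∀ K' ⊆ Ω', IsCompact K' → ∀ K ⊆ Ω, IsCompact K →
    ∀ (α : List (Fin p)) (βx : List (Fin q)) (βy : List (Fin n)),
    ∃ C : ℝ, ∀ x ∈ K', ∀ y ∈ K, ∀ ξ : Euc p,
      jb ξ ^ (-m + ρ * (α.length : ℝ) - δ * ((βx.length + βy.length : ℕ) : ℝ)) *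
        ‖dirDs (α.map eXi3 ++ βx.map eX3 ++ βy.map eY3) (a ε) (x, y, ξ)‖ ≤ C) ∧
  ∀ K' ⊆ Ω', IsCompact K' → ∀ K ⊆ Ω, IsCompact K → ∃ N : ℕ,
    ∀ (α : List (Fin p)) (βx : List (Fin q)) (βy : List (Fin n)),
    ∃ C > 0, ∃ η ∈ Set.Ioc (0:ℝ) 1, ∀ ε ∈ Set.Ioc (0:ℝ) η,
      ∀ x ∈ K', ∀ y ∈ K, ∀ ξ : Euc p,
      jb ξ ^ (-m + ρ * (α.length : ℝ) - δ * ((βx.length + βy.length : ℕ) : ℝ)) *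
        ‖dirDs (α.map eXi3 ++ βx.map eX3 ++ βy.map eY3) (a ε) (x, y, ξ)‖ ≤ C * ε ^ (-(N : ℤ))

/-- Moderate net of order −∞ on Ω'×Ω×ℝ^p. -/
def Smoothing3Moderate {q n p : ℕ} (Ω' : Set (Euc q)) (Ω : Set (Euc n))
    (a : ℝ → Euc q × Euc n × Euc p → ℂ) : Prop :=
  (∀ ε ∈ Set.Ioc (0:ℝ) 1, ContDiffOn ℝ (⊤ : ℕ∞) (a ε) (Ω' ×ˢ Ω ×ˢ (univ : Set (Euc p)))) ∧
  (∀ ε ∈ Set.Ioc (0:ℝ) 1, ∀ m : ℝ, ∀ K' ⊆ Ω', IsCompact K' → ∀ K ⊆ Ω, IsCompact K →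
    ∀ (α : List (Fin p)) (βx : List (Fin q)) (βy : List (Fin n)),
    ∃ C : ℝ, ∀ x ∈ K', ∀ y ∈ K, ∀ ξ : Euc p,
      jb ξ ^ (-m + (α.length : ℝ)) *
        ‖dirDs (α.map eXi3 ++ βx.map eX3 ++ βy.map eY3) (a ε) (x, y, ξ)‖ ≤ C) ∧
  ∀ m : ℝ, ∀ K' ⊆ Ω', IsCompact K' → ∀ K ⊆ Ω, IsCompact K →
    ∀ (α : List (Fin p)) (βx : List (Fin q)) (βy : List (Fin n)),
    ∃ N : ℕ, ∃ C > 0, ∃ η ∈ Set.Ioc (0:ℝ) 1, ∀ ε ∈ Set.Ioc (0:ℝ) η,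
      ∀ x ∈ K', ∀ y ∈ K, ∀ ξ : Euc p,
      jb ξ ^ (-m + (α.length : ℝ)) *
        ‖dirDs (α.map eXi3 ++ βx.map eX3 ++ βy.map eY3) (a ε) (x, y, ξ)‖ ≤ C * ε ^ (-(N : ℤ))

/-- Regular net of order −∞ on Ω'×Ω×ℝ^p. -/
def Smoothing3Regular {q n p : ℕ} (Ω' : Set (Euc q)) (Ω : Set (Euc n))
    (a : ℝ → Euc q × Euc n × Euc p → ℂ) : Prop :=
  (∀ ε ∈ Set.Ioc (0:ℝ) 1, ContDiffOn ℝ (⊤ : ℕ∞) (a ε) (Ω' ×ˢ Ω ×ˢ (univ : Set (Euc p)))) ∧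
  (∀ ε ∈ Set.Ioc (0:ℝ) 1, ∀ m : ℝ, ∀ K' ⊆ Ω', IsCompact K' → ∀ K ⊆ Ω, IsCompact K →
    ∀ (α : List (Fin p)) (βx : List (Fin q)) (βy : List (Fin n)),
    ∃ C : ℝ, ∀ x ∈ K', ∀ y ∈ K, ∀ ξ : Euc p,
      jb ξ ^ (-m + (α.length : ℝ)) *
        ‖dirDs (α.map eXi3 ++ βx.map eX3 ++ βy.map eY3) (a ε) (x, y, ξ)‖ ≤ C) ∧
  ∀ K' ⊆ Ω', IsCompact K' → ∀ K ⊆ Ω, IsCompact K → ∃ N : ℕ, ∀ m : ℝ,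
    ∀ (α : List (Fin p)) (βx : List (Fin q)) (βy : List (Fin n)),
    ∃ C > 0, ∃ η ∈ Set.Ioc (0:ℝ) 1, ∀ ε ∈ Set.Ioc (0:ℝ) η,
      ∀ x ∈ K', ∀ y ∈ K, ∀ ξ : Euc p,
      jb ξ ^ (-m + (α.length : ℝ)) *
        ‖dirDs (α.map eXi3 ++ βx.map eX3 ++ βy.map eY3) (a ε) (x, y, ξ)‖ ≤ C * ε ^ (-(N : ℤ))

/-- Nets of phase functions with parameter x ∈ Ω'. -/
def IsPhaseNet3 {q n p : ℕ} (Ω' : Set (Euc q)) (Ω : Set (Euc n))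
    (φ : ℝ → Euc q × Euc n × Euc p → ℝ) : Prop :=
  ∀ ε ∈ Set.Ioc (0:ℝ) 1,
    ContinuousOn (φ ε) (Ω' ×ˢ Ω ×ˢ (univ : Set (Euc p))) ∧
    ContDiffOn ℝ (⊤ : ℕ∞) (φ ε) (Ω' ×ˢ Ω ×ˢ {ξ : Euc p | ξ ≠ 0}) ∧
    (∀ x ∈ Ω', ∀ y ∈ Ω, ∀ ξ : Euc p, ξ ≠ 0 → ∀ t : ℝ, 0 < t →
      φ ε (x, y, t • ξ) = t * φ ε (x, y, ξ)) ∧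
    (∀ x ∈ Ω', ∀ y ∈ Ω, ∀ ξ : Euc p, ξ ≠ 0 → gradSq3 (φ ε) (x, y, ξ) ≠ 0)

/-- S^1_hg-moderateness in all variables for parametrized phase nets. -/
def Hg3Moderate {q n p : ℕ} (Ω' : Set (Euc q)) (Ω : Set (Euc n)) (m : ℝ)
    (φ : ℝ → Euc q × Euc n × Euc p → ℝ) : Prop :=
  ∀ K' ⊆ Ω', IsCompact K' → ∀ K ⊆ Ω, IsCompact K →
    ∀ (α : List (Fin p)) (βx : List (Fin q)) (βy : List (Fin n)),
    ∃ N : ℕ, ∃ C > 0, ∃ η ∈ Set.Ioc (0:ℝ) 1, ∀ ε ∈ Set.Ioc (0:ℝ) η,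
      ∀ x ∈ K', ∀ y ∈ K, ∀ ξ : Euc p, ξ ≠ 0 →
      ‖ξ‖ ^ (-m + (α.length : ℝ)) *
        ‖dirDs (α.map eXi3 ++ βx.map eX3 ++ βy.map eY3) (φ ε) (x, y, ξ)‖ ≤ C * ε ^ (-(N : ℤ))

def Hg3SlowScale {q n p : ℕ} (Ω' : Set (Euc q)) (Ω : Set (Euc n)) (m : ℝ)
    (φ : ℝ → Euc q × Euc n × Euc p → ℝ) : Prop :=
  ∀ K' ⊆ Ω', IsCompact K' → ∀ K ⊆ Ω, IsCompact K →
    ∀ (α : List (Fin p)) (βx : List (Fin q)) (βy : List (Fin n)),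
    ∃ s : ℝ → ℝ, SlowScale s ∧ ∃ η ∈ Set.Ioc (0:ℝ) 1, ∀ ε ∈ Set.Ioc (0:ℝ) η,
      ∀ x ∈ K', ∀ y ∈ K, ∀ ξ : Euc p, ξ ≠ 0 →
      ‖ξ‖ ^ (-m + (α.length : ℝ)) *
        ‖dirDs (α.map eXi3 ++ βx.map eX3 ++ βy.map eY3) (φ ε) (x, y, ξ)‖ ≤ s ε

/-- M_Φ(Ω';Ω×ℝ^p). -/
def MPhi3 {q n p : ℕ} (Ω' : Set (Euc q)) (Ω : Set (Euc n))
    (φ : ℝ → Euc q × Euc n × Euc p → ℝ) : Prop :=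
  IsPhaseNet3 Ω' Ω φ ∧ Hg3Moderate Ω' Ω 1 φ ∧
  ∀ K' ⊆ Ω', IsCompact K' → ∀ K ⊆ Ω, IsCompact K →
    ∃ r > (0:ℝ), ∃ η ∈ Set.Ioc (0:ℝ) 1, ∀ ε ∈ Set.Ioc (0:ℝ) η,
      ∀ x ∈ K', ∀ y ∈ K, ∀ ξ : Euc p, ξ ≠ 0 →
        ε ^ r ≤ gradSq3 (φ ε) (x, y, ‖ξ‖⁻¹ • ξ)

/-- M_{Φ,sc}(Ω';Ω×ℝ^p). -/
def MPhi3Sc {q n p : ℕ} (Ω' : Set (Euc q)) (Ω : Set (Euc n))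
    (φ : ℝ → Euc q × Euc n × Euc p → ℝ) : Prop :=
  IsPhaseNet3 Ω' Ω φ ∧ Hg3SlowScale Ω' Ω 1 φ ∧
  ∀ K' ⊆ Ω', IsCompact K' → ∀ K ⊆ Ω, IsCompact K →
    ∃ s : ℝ → ℝ, SlowScale s ∧ ∃ η ∈ Set.Ioc (0:ℝ) 1, ∀ ε ∈ Set.Ioc (0:ℝ) η,
      ∀ x ∈ K', ∀ y ∈ K, ∀ ξ : Euc p, ξ ≠ 0 →
        (s ε)⁻¹ ≤ gradSq3 (φ ε) (x, y, ‖ξ‖⁻¹ • ξ)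

def varphiN3 {q n p : ℕ} (φ : Euc q × Euc n × Euc p → ℝ) (z : Euc q × Euc n × Euc p) : ℝ :=
  (gradSq3 φ (z.1, z.2.1, ‖z.2.2‖⁻¹ • z.2.2))⁻¹

def coefA3 {q n p : ℕ} (χ : Euc p → ℝ) (φ : Euc q × Euc n × Euc p → ℝ) (j : Fin p) :
    Euc q × Euc n × Euc p → ℂ :=
  fun z => Complex.I * (((1 - χ z.2.2) * varphiN3 φ z * dirD (eXi3 j) φ z : ℝ) : ℂ)

def coefB3 {q n p : ℕ} (χ : Euc p → ℝ) (φ : Euc q × Euc n × Euc p → ℝ) (k : Fin n) :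
    Euc q × Euc n × Euc p → ℂ :=
  fun z => Complex.I * (((1 - χ z.2.2) * (‖z.2.2‖ ^ 2)⁻¹ * varphiN3 φ z * dirD (eY3 k) φ z : ℝ) : ℂ)

def coefC3 {q n p : ℕ} (χ : Euc p → ℝ) (φ : Euc q × Euc n × Euc p → ℝ) :
    Euc q × Euc n × Euc p → ℂ :=
  fun z => ((χ z.2.2 : ℝ) : ℂ) + (∑ j : Fin p, dirD (eXi3 j) (coefA3 χ φ j) z)
    + ∑ k : Fin n, dirD (eY3 k) (coefB3 χ φ k) z

/-- The operator L_φ(x;y,ξ,∂_y,∂_ξ). -/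
def Lop3 {q n p : ℕ} (χ : Euc p → ℝ) (φ : Euc q × Euc n × Euc p → ℝ)
    (f : Euc q × Euc n × Euc p → ℂ) : Euc q × Euc n × Euc p → ℂ :=
  fun z => (∑ j : Fin p, coefA3 χ φ j z * dirD (eXi3 j) f z)
    + (∑ k : Fin n, coefB3 χ φ k z * dirD (eY3 k) f z) + coefC3 χ φ z * f z


/-- Moderate net of order −∞ on Ω×ℝ^p. -/
def SmoothingModerate {n p : ℕ} (Ω : Set (Euc n)) (a : ℝ → Euc n × Euc p → ℂ) : Prop :=
  (∀ ε ∈ Set.Ioc (0:ℝ) 1, ContDiffOn ℝ (⊤ : ℕ∞) (a ε) (Ω ×ˢ (univ : Set (Euc p)))) ∧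
  (∀ ε ∈ Set.Ioc (0:ℝ) 1, ∀ m : ℝ, ∀ K ⊆ Ω, IsCompact K →
    ∀ (α : List (Fin p)) (β : List (Fin n)),
    ∃ C : ℝ, ∀ y ∈ K, ∀ ξ : Euc p,
      jb ξ ^ (-m + (α.length : ℝ)) *
        ‖dirDs (α.map eXi ++ β.map eY) (a ε) (y, ξ)‖ ≤ C) ∧
  ∀ m : ℝ, ∀ K ⊆ Ω, IsCompact K → ∀ (α : List (Fin p)) (β : List (Fin n)),
    ∃ N : ℕ, ∃ C > 0, ∃ η ∈ Set.Ioc (0:ℝ) 1, ∀ ε ∈ Set.Ioc (0:ℝ) η, ∀ y ∈ K, ∀ ξ : Euc p,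
      jb ξ ^ (-m + (α.length : ℝ)) *
        ‖dirDs (α.map eXi ++ β.map eY) (a ε) (y, ξ)‖ ≤ C * ε ^ (-(N : ℤ))

/-- Regular net of order −∞ on Ω×ℝ^p. -/
def SmoothingRegular {n p : ℕ} (Ω : Set (Euc n)) (a : ℝ → Euc n × Euc p → ℂ) : Prop :=
  (∀ ε ∈ Set.Ioc (0:ℝ) 1, ContDiffOn ℝ (⊤ : ℕ∞) (a ε) (Ω ×ˢ (univ : Set (Euc p)))) ∧
  (∀ ε ∈ Set.Ioc (0:ℝ) 1, ∀ m : ℝ, ∀ K ⊆ Ω, IsCompact K →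
    ∀ (α : List (Fin p)) (β : List (Fin n)),
    ∃ C : ℝ, ∀ y ∈ K, ∀ ξ : Euc p,
      jb ξ ^ (-m + (α.length : ℝ)) *
        ‖dirDs (α.map eXi ++ β.map eY) (a ε) (y, ξ)‖ ≤ C) ∧
  ∀ K ⊆ Ω, IsCompact K → ∃ N : ℕ, ∀ m : ℝ, ∀ (α : List (Fin p)) (β : List (Fin n)),
    ∃ C > 0, ∃ η ∈ Set.Ioc (0:ℝ) 1, ∀ ε ∈ Set.Ioc (0:ℝ) η, ∀ y ∈ K, ∀ ξ : Euc p,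
      jb ξ ^ (-m + (α.length : ℝ)) *
        ‖dirDs (α.map eXi ++ β.map eY) (a ε) (y, ξ)‖ ≤ C * ε ^ (-(N : ℤ))

/-- Moderate net in S^m_{ρ,δ}(V) on the conic set V = Ω×(ℝ^p∖0). -/
def ConicModerate {n p : ℕ} (Ω : Set (Euc n)) (m ρ δ : ℝ)
    (a : ℝ → Euc n × Euc p → ℂ) : Prop :=
  (∀ ε ∈ Set.Ioc (0:ℝ) 1, ContDiffOn ℝ (⊤ : ℕ∞) (a ε) (Ω ×ˢ {ξ : Euc p | ξ ≠ 0})) ∧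
  (∀ ε ∈ Set.Ioc (0:ℝ) 1, ∀ K ⊆ Ω ×ˢ {ξ : Euc p | ξ ≠ 0}, IsCompact K →
    ∀ (α : List (Fin p)) (β : List (Fin n)), ∃ C : ℝ, ∀ z ∈ K, ∀ t : ℝ, 1 ≤ t →
      jb (t • z.2) ^ (-m + ρ * (α.length : ℝ) - δ * (β.length : ℝ)) *
        ‖dirDs (α.map eXi ++ β.map eY) (a ε) (z.1, t • z.2)‖ ≤ C) ∧
  ∀ K ⊆ Ω ×ˢ {ξ : Euc p | ξ ≠ 0}, IsCompact K →
    ∀ (α : List (Fin p)) (β : List (Fin n)),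
    ∃ N : ℕ, ∃ C > 0, ∃ η ∈ Set.Ioc (0:ℝ) 1, ∀ ε ∈ Set.Ioc (0:ℝ) η, ∀ z ∈ K, ∀ t : ℝ, 1 ≤ t →
      jb (t • z.2) ^ (-m + ρ * (α.length : ℝ) - δ * (β.length : ℝ)) *
        ‖dirDs (α.map eXi ++ β.map eY) (a ε) (z.1, t • z.2)‖ ≤ C * ε ^ (-(N : ℤ))

/-- Negligible net in S^m_{ρ,δ}(V) on the conic set V = Ω×(ℝ^p∖0). -/
def ConicNegligible {n p : ℕ} (Ω : Set (Euc n)) (m ρ δ : ℝ)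
    (a : ℝ → Euc n × Euc p → ℂ) : Prop :=
  (∀ ε ∈ Set.Ioc (0:ℝ) 1, ContDiffOn ℝ (⊤ : ℕ∞) (a ε) (Ω ×ˢ {ξ : Euc p | ξ ≠ 0})) ∧
  (∀ ε ∈ Set.Ioc (0:ℝ) 1, ∀ K ⊆ Ω ×ˢ {ξ : Euc p | ξ ≠ 0}, IsCompact K →
    ∀ (α : List (Fin p)) (β : List (Fin n)), ∃ C : ℝ, ∀ z ∈ K, ∀ t : ℝ, 1 ≤ t →
      jb (t • z.2) ^ (-m + ρ * (α.length : ℝ) - δ * (β.length : ℝ)) *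
        ‖dirDs (α.map eXi ++ β.map eY) (a ε) (z.1, t • z.2)‖ ≤ C) ∧
  ∀ K ⊆ Ω ×ˢ {ξ : Euc p | ξ ≠ 0}, IsCompact K →
    ∀ (α : List (Fin p)) (β : List (Fin n)), ∀ q : ℕ,
    ∃ C > 0, ∃ η ∈ Set.Ioc (0:ℝ) 1, ∀ ε ∈ Set.Ioc (0:ℝ) η, ∀ z ∈ K, ∀ t : ℝ, 1 ≤ t →
      jb (t • z.2) ^ (-m + ρ * (α.length : ℝ) - δ * (β.length : ℝ)) *
        ‖dirDs (α.map eXi ++ β.map eY) (a ε) (z.1, t • z.2)‖ ≤ C * ε ^ q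

/-- A point (x₀,ξ₀) at which |∇_ξφ|² is invertible on a neighborhood U×Γ. -/
def InvPt {n p : ℕ} (Ω : Set (Euc n)) (φ : ℝ → Euc n × Euc p → ℝ)
    (z : Euc n × Euc p) : Prop :=
  ∃ U : Set (Euc n), IsOpen U ∧ z.1 ∈ U ∧ U ⊆ Ω ∧ IsCompact (closure U) ∧
  ∃ Γ : Set (Euc p), IsOpen Γ ∧ z.2 ∈ Γ ∧ (∀ ξ ∈ Γ, ∀ t : ℝ, 0 < t → t • ξ ∈ Γ) ∧
  ∃ r : ℝ, ∃ η ∈ Set.Ioc (0:ℝ) 1, ∀ ε ∈ Set.Ioc (0:ℝ) η, ∀ y ∈ U, ∀ ξ ∈ Γ,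
    ε ^ r ≤ gradXiSq (φ ε) (y, ξ)

/-- A point (x₀,ξ₀) at which |∇_ξφ|² is slow scale-invertible on a neighborhood U×Γ. -/
def InvPtSc {n p : ℕ} (Ω : Set (Euc n)) (φ : ℝ → Euc n × Euc p → ℝ)
    (z : Euc n × Euc p) : Prop :=
  ∃ U : Set (Euc n), IsOpen U ∧ z.1 ∈ U ∧ U ⊆ Ω ∧ IsCompact (closure U) ∧
  ∃ Γ : Set (Euc p), IsOpen Γ ∧ z.2 ∈ Γ ∧ (∀ ξ ∈ Γ, ∀ t : ℝ, 0 < t → t • ξ ∈ Γ) ∧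
  ∃ s : ℝ → ℝ, SlowScale s ∧ ∃ η ∈ Set.Ioc (0:ℝ) 1, ∀ ε ∈ Set.Ioc (0:ℝ) η, ∀ y ∈ U, ∀ ξ ∈ Γ,
    (s ε)⁻¹ ≤ gradXiSq (φ ε) (y, ξ)

/-- The set C_φ. -/
def Cphi {n p : ℕ} (Ω : Set (Euc n)) (φ : ℝ → Euc n × Euc p → ℝ) : Set (Euc n × Euc p) :=
  {z | z.1 ∈ Ω ∧ z.2 ≠ 0 ∧ ¬ InvPt Ω φ z}

/-- The set R_φ = Ω ∖ π_Ω(C_φ). -/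
def Rphi {n p : ℕ} (Ω : Set (Euc n)) (φ : ℝ → Euc n × Euc p → ℝ) : Set (Euc n) :=
  Ω \ (Prod.fst '' Cphi Ω φ)

/-- The set C^sc_φ. -/
def CphiSc {n p : ℕ} (Ω : Set (Euc n)) (φ : ℝ → Euc n × Euc p → ℝ) : Set (Euc n × Euc p) :=
  {z | z.1 ∈ Ω ∧ z.2 ≠ 0 ∧ ¬ InvPtSc Ω φ z}

/-- The set R^sc_φ = Ω ∖ π_Ω(C^sc_φ). -/
def RphiSc {n p : ℕ} (Ω : Set (Euc n)) (φ : ℝ → Euc n × Euc p → ℝ) : Set (Euc n) :=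
  Ω \ (Prod.fst '' CphiSc Ω φ)

/-- 1/|∇_ξφ(y,ξ/|ξ|)|². -/
def varphiXi {n p : ℕ} (φ : Euc n × Euc p → ℝ) (z : Euc n × Euc p) : ℝ :=
  (gradXiSq φ (z.1, ‖z.2‖⁻¹ • z.2))⁻¹

/-- The transposed regularizing operator in the ξ-variables only:
    ᵗL f = −Σ_j a_j ∂_{ξ_j} f + χ f  with a_j = i(1−χ)|∇_ξφ|⁻²∂_{ξ_j}φ. -/
def tLxi {n p : ℕ} (χ : Euc p → ℝ) (φ : Euc n × Euc p → ℝ) (f : Euc n × Euc p → ℂ) :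
    Euc n × Euc p → ℂ :=
  fun z => -(∑ j : Fin p,
      (Complex.I * (((1 - χ z.2) * varphiXi φ z * dirD (eXi j) φ z : ℝ) : ℂ)) *
        dirD (eXi j) f z)
    + ((χ z.2 : ℝ) : ℂ) * f z

/-- d_{j}(y,θ,ξ) = (ξ_j − ∂_{y_j}φ(y,θ))/|ξ−∇_yφ(y,θ)|². -/
def dj {n p : ℕ} (φ : Euc n × Euc p → ℝ) (ξ : Euc n) (j : Fin n)
    (z : Euc n × Euc p) : ℝ :=
  (ξ j - dirD (eY j) φ z) / ‖ξ - gradY φ z‖ ^ 2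

/-- ᵗL_ε f = −Σ_j d_j D_{y_j} f − Σ_j (D_{y_j} d_j) f, with D_{y_j} = −i∂_{y_j}. -/
def tLW {n p : ℕ} (φ : Euc n × Euc p → ℝ) (ξ : Euc n) (f : Euc n × Euc p → ℂ) :
    Euc n × Euc p → ℂ :=
  fun z => -(∑ j : Fin n, ((dj φ ξ j z : ℝ) : ℂ) * (-Complex.I * dirD (eY j) f z))
    - ∑ j : Fin n, (-Complex.I * ((dirD (eY j) (dj φ ξ j) z : ℝ) : ℂ)) * f z

/-- A function on `ℝ^q × ℝ^n × ℝ^p` which is smooth over `Ω'`, vanishes for `y ∉ K`, and whose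
`x`-derivatives all decay like `⟨ξ⟩^{-(p+1)}`, locally uniformly in `x ∈ Ω'`. -/
structure SmoothRapid {q n p : ℕ} (Ω' : Set (Euc q)) (K : Set (Euc n))
    (f : Euc q × Euc n × Euc p → ℂ) : Prop where
  smooth : ContDiffOn ℝ (⊤ : ℕ∞) f (Ω' ×ˢ univ)
  supp : ∀ x y ξ, y ∉ K → f (x, y, ξ) = 0
  bound : ∀ K' ⊆ Ω', IsCompact K' → ∀ L : List (Fin q), ∃ C : ℝ, ∀ x ∈ K', ∀ y ∈ K, ∀ ξ : Euc p,
    jb ξ ^ ((p : ℝ) + 1) * ‖dirDs (L.map eX3) f (x, y, ξ)‖ ≤ C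

/-- The integrable weight `1_K(y) ⟨ξ⟩^{-(p+1)}`. -/
def decayWeight {n p : ℕ} (K : Set (Euc n)) (w : Euc n × Euc p) : ℝ :=
  K.indicator (fun _ => (1 : ℝ)) w.1 * jb w.2 ^ (-((p : ℝ) + 1))

lemma jb_pos {d : ℕ} (ξ : Euc d) : 0 < jb ξ := Real.sqrt_pos.2 (by positivity)

lemma decayWeight_nonneg {n p : ℕ} (K : Set (Euc n)) (w : Euc n × Euc p) :
    0 ≤ decayWeight K w :=
  mul_nonneg (indicator_nonneg (fun _ _ => zero_le_one) _) (Real.rpow_nonneg (jb_pos _).le _)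

lemma integrable_decayWeight {n p : ℕ} {K : Set (Euc n)} (hK : IsCompact K) :
    Integrable (decayWeight K : Euc n × Euc p → ℝ) := by
  have h1 : Integrable (K.indicator (fun _ => (1 : ℝ))) :=
    (integrable_indicator_iff hK.measurableSet).2 (integrableOn_const hK.measure_lt_top.ne)
  have h2 : Integrable (fun ξ : Euc p => jb ξ ^ (-((p : ℝ) + 1))) := by
    have := integrable_rpow_neg_one_add_norm_sq (E := Euc p) (μ := volume) (r := (p : ℝ) + 1)
      (by simp)
    refine this.congr (Filter.Eventually.of_forall fun ξ => ?_)
    simp only [jb, Real.sqrt_eq_rpow]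
    rw [← Real.rpow_mul (by positivity)]
    congr 1
    ring
  exact h1.mul_prod h2

lemma norm_le_mul_decayWeight {q n p : ℕ} {K : Set (Euc n)} {g : Euc q × Euc n × Euc p → ℂ}
    (hg : ∀ x y ξ, y ∉ K → g (x, y, ξ) = 0) {C : ℝ} {x : Euc q}
    (h : ∀ y ∈ K, ∀ ξ : Euc p, jb ξ ^ ((p : ℝ) + 1) * ‖g (x, y, ξ)‖ ≤ C) (w : Euc n × Euc p) :
    ‖g (x, w)‖ ≤ C * decayWeight K w := by
  obtain ⟨y, ξ⟩ := w
  by_cases hy : y ∈ K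
  · have hpos : 0 < jb ξ ^ ((p : ℝ) + 1) := Real.rpow_pos_of_pos (jb_pos ξ) _
    simp only [decayWeight, indicator_of_mem hy, one_mul, Real.rpow_neg (jb_pos ξ).le]
    rw [← div_eq_mul_inv, le_div_iff₀ hpos, mul_comm]
    exact h y hy ξ
  · simp [decayWeight, hg x y ξ hy, hy]

lemma dirDs_append {E F : Type*} [NormedAddCommGroup E] [NormedSpace ℝ E]
    [NormedAddCommGroup F] [NormedSpace ℝ F] (L M : List E) (f : E → F) :
    dirDs (L ++ M) f = dirDs L (dirDs M f) := by
  simp [dirDs]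

lemma dirD_eq_zero_of_notMem {q n p : ℕ} {K : Set (Euc n)} (hK : IsClosed K)
    {f : Euc q × Euc n × Euc p → ℂ} (hf : ∀ x y ξ, y ∉ K → f (x, y, ξ) = 0)
    (v : Euc q × Euc n × Euc p) (x : Euc q) (y : Euc n) (ξ : Euc p) (hy : y ∉ K) :
    dirD v f (x, y, ξ) = 0 := by
  have hopen : IsOpen {z : Euc q × Euc n × Euc p | z.2.1 ∉ K} :=
    hK.isOpen_compl.preimage (by fun_prop)
  have h : f =ᶠ[𝓝 (x, y, ξ)] fun _ => (0 : ℂ) := by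
    filter_upwards [hopen.mem_nhds hy] with z hz using hf z.1 z.2.1 z.2.2 hz
  simp [dirD, h.fderiv_eq]

lemma ContDiffOn.dirD_of_isOpen {E F : Type*} [NormedAddCommGroup E] [NormedSpace ℝ E]
    [NormedAddCommGroup F] [NormedSpace ℝ F] {f : E → F} {s : Set E}
    (hf : ContDiffOn ℝ (⊤ : ℕ∞) f s) (hs : IsOpen s) (v : E) :
    ContDiffOn ℝ (⊤ : ℕ∞) (dirD v f) s :=
  (hf.fderiv_of_isOpen hs (m := (⊤ : ℕ∞)) (by simp)).clm_apply contDiffOn_const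

lemma opNorm_le_sum_single {q : ℕ} {F : Type*} [NormedAddCommGroup F] [NormedSpace ℝ F]
    (A : Euc q →L[ℝ] F) : ‖A‖ ≤ ∑ i : Fin q, ‖A (EuclideanSpace.single i 1)‖ := by
  refine A.opNorm_le_bound (Finset.sum_nonneg fun _ _ => norm_nonneg _) fun x => ?_
  have hx : x = ∑ i, x i • EuclideanSpace.single i (1 : ℝ) := by
    simpa using ((EuclideanSpace.basisFun (Fin q) ℝ).sum_repr x).symm
  calc ‖A x‖ = ‖∑ i, x i • A (EuclideanSpace.single i (1 : ℝ))‖ := by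
        conv_lhs => rw [hx]
        simp
    _ ≤ ∑ i, ‖x i • A (EuclideanSpace.single i (1 : ℝ))‖ := norm_sum_le _ _
    _ ≤ ∑ i, ‖A (EuclideanSpace.single i 1)‖ * ‖x‖ := by
        refine Finset.sum_le_sum fun i _ => ?_
        rw [norm_smul, mul_comm]
        exact mul_le_mul_of_nonneg_left (PiLp.norm_apply_le x i) (norm_nonneg _)
    _ = _ := (Finset.sum_mul _ _ _).symm

/-- The partial Fréchet derivative of `f` with respect to its first variable. -/
def fderivFst {q n p : ℕ} (f : Euc q × Euc n × Euc p → ℂ) (x : Euc q) (w : Euc n × Euc p) :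
    Euc q →L[ℝ] ℂ :=
  (fderiv ℝ f (x, w)).comp (ContinuousLinearMap.inl ℝ (Euc q) (Euc n × Euc p))

namespace SmoothRapid

variable {q n p : ℕ} {Ω' : Set (Euc q)} {K : Set (Euc n)} {f : Euc q × Euc n × Euc p → ℂ}

protected lemma dirD (hΩ' : IsOpen Ω') (hK : IsClosed K) (hf : SmoothRapid Ω' K f) (i : Fin q) :
    SmoothRapid Ω' K (dirD (eX3 i) f) where
  smooth := hf.smooth.dirD_of_isOpen (hΩ'.prod isOpen_univ) _
  supp := dirD_eq_zero_of_notMem hK hf.supp _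
  bound K' hK' hK'c L := by
    obtain ⟨C, hC⟩ := hf.bound K' hK' hK'c (L ++ [i])
    refine ⟨C, fun x hx y hy ξ => ?_⟩
    have := hC x hx y hy ξ
    rwa [List.map_append, dirDs_append] at this

protected lemma dirDs (hΩ' : IsOpen Ω') (hK : IsClosed K) (hf : SmoothRapid Ω' K f) (L : List (Fin q)) :
    SmoothRapid Ω' K (dirDs (L.map eX3) f) := by
  induction L with
  | nil => exact hf
  | cons i L ih => exact ih.dirD hΩ' hK i

lemma continuous_slice (hf : SmoothRapid Ω' K f) {x : Euc q} (hx : x ∈ Ω') :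
    Continuous fun w => f (x, w) :=
  hf.smooth.continuousOn.comp_continuous (by fun_prop) fun _ => ⟨hx, mem_univ _⟩

lemma integrable (hK : IsCompact K) (hf : SmoothRapid Ω' K f) {x : Euc q}
    (hx : x ∈ Ω') : Integrable fun w => f (x, w) := by
  obtain ⟨C, hC⟩ := hf.bound {x} (by simpa using hx) isCompact_singleton []
  exact ((integrable_decayWeight hK).const_mul C).mono'
    (hf.continuous_slice hx).aestronglyMeasurable
    (Filter.Eventually.of_forall (norm_le_mul_decayWeight hf.supp (hC x rfl)))

lemma norm_fderivFst_le (hK : IsCompact K) (hf : SmoothRapid Ω' K f) {K' : Set (Euc q)}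
    (hK' : K' ⊆ Ω') (hK'c : IsCompact K') :
    ∃ C : ℝ, ∀ x ∈ K', ∀ w, ‖fderivFst f x w‖ ≤ C * decayWeight K w := by
  choose C hC using fun i => hf.bound K' hK' hK'c [i]
  refine ⟨∑ i, C i, fun x hx w => (opNorm_le_sum_single _).trans ?_⟩
  rw [Finset.sum_mul]
  exact Finset.sum_le_sum fun i _ => norm_le_mul_decayWeight
    (dirD_eq_zero_of_notMem hK.isClosed hf.supp (eX3 i)) (hC i x hx) w

lemma continuous_fderivFst (hΩ' : IsOpen Ω') (hf : SmoothRapid Ω' K f) {x : Euc q}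
    (hx : x ∈ Ω') : Continuous (fderivFst f x) := by
  have h := (hf.smooth.continuousOn_fderiv_of_isOpen (hΩ'.prod isOpen_univ)
    (by simp)).comp_continuous (f := fun w => (x, w)) (by fun_prop) fun _ => ⟨hx, mem_univ _⟩
  exact h.clm_comp continuous_const

lemma hasFDerivAt_slice (hΩ' : IsOpen Ω') (hf : SmoothRapid Ω' K f) {x : Euc q} (hx : x ∈ Ω')
    (w : Euc n × Euc p) : HasFDerivAt (fun x => f (x, w)) (fderivFst f x w) x :=
  HasFDerivAt.comp (g := f) (f := fun x => (x, w)) x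
    ((hf.smooth.contDiffAt ((hΩ'.prod isOpen_univ).mem_nhds ⟨hx, mem_univ _⟩)).differentiableAt
      (by simp)).hasFDerivAt (hasFDerivAt_prodMk_left x w)

lemma integrable_fderivFst (hΩ' : IsOpen Ω') (hK : IsCompact K) (hf : SmoothRapid Ω' K f)
    {x : Euc q} (hx : x ∈ Ω') : Integrable (fderivFst f x) := by
  obtain ⟨C, hC⟩ := hf.norm_fderivFst_le hK (singleton_subset_iff.2 hx) isCompact_singleton
  exact ((integrable_decayWeight hK).const_mul C).mono'
    (hf.continuous_fderivFst hΩ' hx).aestronglyMeasurable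
    (Filter.Eventually.of_forall (hC x rfl))

lemma hasFDerivAt_integral_fderivFst (hΩ' : IsOpen Ω') (hK : IsCompact K)
    (hf : SmoothRapid Ω' K f) {x : Euc q} (hx : x ∈ Ω') :
    HasFDerivAt (fun x => ∫ w, f (x, w)) (∫ w, fderivFst f x w) x := by
  obtain ⟨r, hr, hball⟩ := Metric.nhds_basis_closedBall.mem_iff.1 (hΩ'.mem_nhds hx)
  obtain ⟨C, hC⟩ := hf.norm_fderivFst_le hK hball (isCompact_closedBall x r)
  have hmeas : ∀ᶠ x' in 𝓝 x, AEStronglyMeasurable (fun w => f (x', w)) := by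
    filter_upwards [hΩ'.mem_nhds hx] with x' hx'
    exact (hf.continuous_slice hx').aestronglyMeasurable
  exact hasFDerivAt_integral_of_dominated_of_fderiv_le (𝕜 := ℝ)
    (Metric.closedBall_mem_nhds x hr) hmeas (hf.integrable hK hx)
    (hf.continuous_fderivFst hΩ' hx).aestronglyMeasurable
    (Filter.Eventually.of_forall fun w x' hx' => hC x' hx' w)
    ((integrable_decayWeight hK).const_mul C)
    (Filter.Eventually.of_forall fun w x' hx' => hf.hasFDerivAt_slice hΩ' (hball hx') w)

lemma hasFDerivAt_integral (hΩ' : IsOpen Ω') (hK : IsCompact K) (hf : SmoothRapid Ω' K f)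
    {x : Euc q} (hx : x ∈ Ω') :
    ∃ A : Euc q →L[ℝ] ℂ, HasFDerivAt (fun x => ∫ w, f (x, w)) A x ∧
      ∀ i, A (EuclideanSpace.single i 1) = ∫ w, dirD (eX3 i) f (x, w) :=
  ⟨_, hf.hasFDerivAt_integral_fderivFst hΩ' hK hx, fun _ =>
    ContinuousLinearMap.integral_apply (hf.integrable_fderivFst hΩ' hK hx) _⟩

lemma contDiffOn_integral (hΩ' : IsOpen Ω') (hK : IsCompact K) (hf : SmoothRapid Ω' K f) :
    ContDiffOn ℝ (⊤ : ℕ∞) (fun x => ∫ w, f (x, w)) Ω' := by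
  refine contDiffOn_infty.2 fun k => ?_
  induction k generalizing f with
  | zero =>
    refine contDiffOn_zero.2 fun x hx => ?_
    obtain ⟨A, hA, -⟩ := hf.hasFDerivAt_integral hΩ' hK hx
    exact hA.continuousAt.continuousWithinAt
  | succ k ih =>
    push_cast
    refine (contDiffOn_succ_iff_fderiv_of_isOpen hΩ').2 ⟨fun x hx => ?_, by simp, ?_⟩
    · obtain ⟨A, hA, -⟩ := hf.hasFDerivAt_integral hΩ' hK hx
      exact hA.differentiableAt.differentiableWithinAt
    · refine contDiffOn_clm_apply.2 fun v => ?_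
      have hsum : ContDiffOn ℝ k
          (fun x => ∑ i, v i • ∫ w, dirD (eX3 i) f (x, w)) Ω' :=
        ContDiffOn.sum fun i _ => (ih (hf.dirD hΩ' hK.isClosed i)).const_smul (v i)
      refine hsum.congr fun x hx => ?_
      obtain ⟨A, hA, hAi⟩ := hf.hasFDerivAt_integral hΩ' hK hx
      have hv : v = ∑ i, v i • EuclideanSpace.single i (1 : ℝ) := by
        simpa using ((EuclideanSpace.basisFun (Fin q) ℝ).sum_repr v).symm
      rw [hA.fderiv]
      conv_lhs => rw [hv]
      simp only [map_sum, map_smul, hAi]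

lemma dirDs_const_mul_integral (hΩ' : IsOpen Ω') (hK : IsCompact K) (hf : SmoothRapid Ω' K f)
    (c : ℂ) (L : List (Fin q)) {x : Euc q} (hx : x ∈ Ω') :
    dirDs (basisL L) (fun x => c * ∫ w, f (x, w)) x =
      c * ∫ w, dirDs (L.map eX3) f (x, w) := by
  induction L generalizing x with
  | nil => rfl
  | cons i L ih =>
    obtain ⟨A, hA, hAi⟩ := (hf.dirDs hΩ' hK.isClosed L).hasFDerivAt_integral hΩ' hK hx
    have h : dirDs (basisL L) (fun x => c * ∫ w, f (x, w)) =ᶠ[𝓝 x]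
        fun x => c * ∫ w, dirDs (L.map eX3) f (x, w) := by
      filter_upwards [hΩ'.mem_nhds hx] with x' hx' using ih hx'
    change fderiv ℝ (dirDs (basisL L) fun x => c * ∫ w, f (x, w)) x
      (EuclideanSpace.single i 1) = _
    rw [h.fderiv_eq, (hA.const_mul c).fderiv]
    simp [hAi, dirDs]

lemma norm_dirDs_const_mul_integral_le (hΩ' : IsOpen Ω') (hK : IsCompact K)
    (hf : SmoothRapid Ω' K f) (c : ℂ) (L : List (Fin q)) {x : Euc q} (hx : x ∈ Ω') {C : ℝ}
    (hC : ∀ y ∈ K, ∀ ξ : Euc p,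
      jb ξ ^ ((p : ℝ) + 1) * ‖dirDs (L.map eX3) f (x, y, ξ)‖ ≤ C) :
    ‖dirDs (basisL L) (fun x => c * ∫ w, f (x, w)) x‖ ≤
      ‖c‖ * (C * ∫ w : Euc n × Euc p, decayWeight K w) := by
  rw [hf.dirDs_const_mul_integral hΩ' hK c L hx, norm_mul, ← integral_const_mul]
  refine mul_le_mul_of_nonneg_left ?_ (norm_nonneg c)
  exact norm_integral_le_of_norm_le ((integrable_decayWeight hK).const_mul C)
    (Filter.Eventually.of_forall
      (norm_le_mul_decayWeight (hf.dirDs hΩ' hK.isClosed L).supp hC))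

/-- A net of rapidly decaying functions with a moderate bound on an `x`-derivative gives the same
bound, up to a constant, for that derivative of the integrals. -/
lemma exists_bound_dirDs_integral (hΩ' : IsOpen Ω') (hK : IsCompact K)
    {b : ℝ → Euc q × Euc n × Euc p → ℂ} (hb : ∀ ε ∈ Ioc (0 : ℝ) 1, SmoothRapid Ω' K (b ε)) (c : ℂ)
    {K' : Set (Euc q)} (hK' : K' ⊆ Ω') (L : List (Fin q)) (N : ℕ)
    (h : ∃ C > 0, ∃ η ∈ Ioc (0 : ℝ) 1, ∀ ε ∈ Ioc (0 : ℝ) η, ∀ x ∈ K', ∀ y ∈ K, ∀ ξ : Euc p,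
      jb ξ ^ ((p : ℝ) + 1) * ‖dirDs (L.map eX3) (b ε) (x, y, ξ)‖ ≤ C * ε ^ (-(N : ℤ))) :
    ∃ C > 0, ∃ η ∈ Ioc (0 : ℝ) 1, ∀ ε ∈ Ioc (0 : ℝ) η, ∀ x ∈ K',
      ‖dirDs (basisL L) (fun x => c * ∫ w, b ε (x, w)) x‖ ≤ C * ε ^ (-(N : ℤ)) := by
  obtain ⟨C, hC, η, hη, h⟩ := h
  have hI : 0 ≤ ∫ w : Euc n × Euc p, decayWeight K w :=
    integral_nonneg (decayWeight_nonneg K)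
  refine ⟨‖c‖ * (C * ∫ w : Euc n × Euc p, decayWeight K w) + 1, by positivity, η, hη,
    fun ε hε x hx => ?_⟩
  have hpow : 0 ≤ ε ^ (-(N : ℤ)) := zpow_nonneg hε.1.le _
  refine ((hb ε ⟨hε.1, hε.2.trans hη.2⟩).norm_dirDs_const_mul_integral_le hΩ' hK c L (hK' hx)
    (h ε hε x hx)).trans ?_
  linarith

end SmoothRapid

lemma contDiffOn_prod_univ_of_support {q n p : ℕ} {Ω' : Set (Euc q)} {Ω K : Set (Euc n)}
    (hΩ' : IsOpen Ω') (hΩ : IsOpen Ω) (hK : IsClosed K) (hKΩ : K ⊆ Ω)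
    {f : Euc q × Euc n × Euc p → ℂ}
    (hf : ContDiffOn ℝ (⊤ : ℕ∞) f (Ω' ×ˢ Ω ×ˢ (univ : Set (Euc p))))
    (hsupp : ∀ x y ξ, y ∉ K → f (x, y, ξ) = 0) :
    ContDiffOn ℝ (⊤ : ℕ∞) f (Ω' ×ˢ univ) := by
  rintro ⟨x, y, ξ⟩ ⟨hx, -⟩
  by_cases hy : y ∈ K
  · exact (hf.contDiffAt ((hΩ'.prod (hΩ.prod isOpen_univ)).mem_nhds
      ⟨hx, hKΩ hy, mem_univ _⟩)).contDiffWithinAt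
  · have hopen : IsOpen {z : Euc q × Euc n × Euc p | z.2.1 ∉ K} :=
      hK.isOpen_compl.preimage (by fun_prop)
    have h : f =ᶠ[𝓝 (x, y, ξ)] fun _ => (0 : ℂ) := by
      filter_upwards [hopen.mem_nhds hy] with z hz using hsupp z.1 z.2.1 z.2.2 hz
    exact (contDiffAt_const.congr_of_eventuallyEq h).contDiffWithinAt

lemma Smoothing3Regular.moderate {q n p : ℕ} {Ω' : Set (Euc q)} {Ω : Set (Euc n)}
    {b : ℝ → Euc q × Euc n × Euc p → ℂ} (hb : Smoothing3Regular Ω' Ω b) :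
    Smoothing3Moderate Ω' Ω b :=
  ⟨hb.1, hb.2.1, fun m K' hK' hK'c K hK hKc α βx βy =>
    let ⟨N, hN⟩ := hb.2.2 K' hK' hK'c K hK hKc
    ⟨N, hN m α βx βy⟩⟩

lemma Smoothing3Moderate.smoothRapid {q n p : ℕ} {Ω' : Set (Euc q)} {Ω K : Set (Euc n)}
    (hΩ' : IsOpen Ω') (hΩ : IsOpen Ω) (hK : IsCompact K) (hKΩ : K ⊆ Ω)
    {b : ℝ → Euc q × Euc n × Euc p → ℂ} (hb : Smoothing3Moderate Ω' Ω b) {ε : ℝ}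
    (hε : ε ∈ Ioc (0 : ℝ) 1) (hsupp : ∀ x y ξ, y ∉ K → b ε (x, y, ξ) = 0) :
    SmoothRapid Ω' K (b ε) where
  smooth := contDiffOn_prod_univ_of_support hΩ' hΩ hK.isClosed hKΩ (hb.1 ε hε) hsupp
  supp := hsupp
  bound K' hK' hK'c L := by
    simpa using hb.2.1 ε hε (-((p : ℝ) + 1)) K' hK' hK'c K hKΩ hK [] L []

/-- integration in (y,ξ) of nets of order −∞ with compact y-support:
moderate nets of order −∞ give E_M(Ω') nets, regular nets of order −∞ give E^∞_M(Ω') nets. -/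
theorem stmt1 {n' n p : ℕ} (Ω' : Set (Euc n')) (Ω : Set (Euc n))
    (hΩ' : IsOpen Ω') (hΩ : IsOpen Ω)
    (b : ℝ → Euc n' × Euc n × Euc p → ℂ)
    (K : Set (Euc n)) (hK : IsCompact K) (hKΩ : K ⊆ Ω)
    (hsupp : ∀ ε ∈ Set.Ioc (0:ℝ) 1, ∀ x : Euc n', ∀ y : Euc n, ∀ ξ : Euc p,
      y ∉ K → b ε (x, y, ξ) = 0) :
    (Smoothing3Moderate Ω' Ω b →
      (∀ ε ∈ Set.Ioc (0:ℝ) 1, ∀ x ∈ Ω',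
        Integrable (fun w : Euc n × Euc p => b ε (x, w.1, w.2))) ∧
      EMod Ω' (fun ε x => ((2 * Real.pi) ^ p)⁻¹ * ∫ w : Euc n × Euc p, b ε (x, w.1, w.2))) ∧
    (Smoothing3Regular Ω' Ω b →
      EModInf Ω' (fun ε x => ((2 * Real.pi) ^ p)⁻¹ * ∫ w : Euc n × Euc p, b ε (x, w.1, w.2))) := by
  have hrapid (hb : Smoothing3Moderate Ω' Ω b) :
      ∀ ε ∈ Ioc (0 : ℝ) 1, SmoothRapid Ω' K (b ε) := fun ε hε =>
    hb.smoothRapid hΩ' hΩ hK hKΩ hε (hsupp ε hε)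
  refine ⟨fun hb => ⟨fun ε hε x hx => (hrapid hb ε hε).integrable hK hx, fun ε hε =>
    contDiffOn_const.mul ((hrapid hb ε hε).contDiffOn_integral hΩ' hK), ?_⟩, fun hb => ⟨fun ε hε =>
    contDiffOn_const.mul ((hrapid hb.moderate ε hε).contDiffOn_integral hΩ' hK), ?_⟩⟩
  · intro K' hK' hK'c L
    obtain ⟨N, hN⟩ := hb.2.2 (-((p : ℝ) + 1)) K' hK' hK'c K hKΩ hK [] L []
    exact ⟨N, SmoothRapid.exists_bound_dirDs_integral hΩ' hK (hrapid hb) _ hK' L N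
      (by simpa using hN)⟩
  · intro K' hK' hK'c
    obtain ⟨N, hN⟩ := hb.2.2 K' hK' hK'c K hKΩ hK
    exact ⟨N, fun L => SmoothRapid.exists_bound_dirDs_integral hΩ' hK (hrapid hb.moderate) _ hK' L N
      (by simpa using hN (-((p : ℝ) + 1)) [] L [])⟩
end
end

section
/- Let (φ_ε)_{ε∈(0,1]} ∈ M_Φ(Ω×ℝ^p) and set φ_{φ_ε}(y,ξ) := |∇_{y,ξ}φ_ε(y,ξ/|ξ|)|^{−2} for (y,ξ) ∈ Ω×(ℝ^p∖0). Then each φ_{φ_ε} is a smooth function on Ω×(ℝ^p∖0), positively homogeneous of degree 0 in ξ, and the net (φ_{φ_ε})_ε is a moderate net in S^0_hg(Ω×ℝ^p∖0): for every compact K ⊆ Ω and all multi-indices α, β there exists N ∈ ℕ with sup_{y∈K, ξ≠0} |ξ|^{|α|} |∂^α_ξ ∂^β_y φ_{φ_ε}(y,ξ)| = O(ε^{−N}) as ε→0. -/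
open MeasureTheory Set
open scoped BigOperators Topology Real

noncomputable section

/-- The domain `Ω × (ℝ^p ∖ 0)`. -/
def punctured {n : ℕ} (p : ℕ) (Ω : Set (Euc n)) : Set (Euc n × Euc p) :=
  Ω ×ˢ {ξ : Euc p | ξ ≠ 0}

lemma isOpen_punctured {n p : ℕ} {Ω : Set (Euc n)} (hΩ : IsOpen Ω) : IsOpen (punctured p Ω) :=
  hΩ.prod isOpen_ne

section Derivatives

variable {E : Type*} [NormedAddCommGroup E] [NormedSpace ℝ E] {U : Set E} {f g : E → ℝ}

lemma dirD_contDiffOn (hU : IsOpen U) (hf : ContDiffOn ℝ (⊤ : ℕ∞) f U) (v : E) :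
    ContDiffOn ℝ (⊤ : ℕ∞) (dirD v f) U :=
  (hf.fderiv_of_isOpen hU (by simp)).clm_apply contDiffOn_const

lemma dirDs_contDiffOn (hU : IsOpen U) (hf : ContDiffOn ℝ (⊤ : ℕ∞) f U) (L : List E) :
    ContDiffOn ℝ (⊤ : ℕ∞) (dirDs L f) U := by
  induction L with
  | nil => exact hf
  | cons v L ih => exact dirD_contDiffOn hU ih v

lemma dirD_const (v : E) (c : ℝ) : dirD v (fun _ : E => c) = fun _ => 0 := by
  funext x
  simp [dirD]

lemma dirD_congr (hU : IsOpen U) (h : EqOn f g U) (v : E) : EqOn (dirD v f) (dirD v g) U := by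
  intro x hx
  have : f =ᶠ[𝓝 x] g := h.eventuallyEq_of_mem (hU.mem_nhds hx)
  simp only [dirD, this.fderiv_eq]

lemma ContDiffOn.differentiableAt_of_isOpen (hU : IsOpen U)
    (hf : ContDiffOn ℝ (⊤ : ℕ∞) f U) {x : E} (hx : x ∈ U) : DifferentiableAt ℝ f x :=
  (hf.contDiffAt (hU.mem_nhds hx)).differentiableAt (by simp)

lemma dirD_comm (hU : IsOpen U) (hf : ContDiffOn ℝ (⊤ : ℕ∞) f U) (v w : E) :
    EqOn (dirD v (dirD w f)) (dirD w (dirD v f)) U := by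
  intro x hx
  have hf' : DifferentiableAt ℝ (fderiv ℝ f) x :=
    ((hf.fderiv_of_isOpen hU (m := (⊤ : ℕ∞)) (by simp)).contDiffAt
      (hU.mem_nhds hx)).differentiableAt (by simp)
  have hsymm : IsSymmSndFDerivAt ℝ f x :=
    (hf.contDiffAt (hU.mem_nhds hx)).isSymmSndFDerivAt
      (by simpa using WithTop.coe_le_coe.2 (le_top : (2 : ℕ∞) ≤ ⊤))
  have key (a b : E) : dirD a (dirD b f) x = fderiv ℝ (fderiv ℝ f) x a b := by
    unfold dirD
    rw [fderiv_clm_apply hf' (differentiableAt_const b)]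
    simp
  rw [key, key, hsymm.eq]

lemma dirDs_perm (hU : IsOpen U) (hf : ContDiffOn ℝ (⊤ : ℕ∞) f U) {L L' : List E}
    (h : L.Perm L') : EqOn (dirDs L f) (dirDs L' f) U := by
  induction h with
  | nil => exact fun _ _ => rfl
  | cons v _ ih => exact dirD_congr hU ih v
  | swap v w L => exact dirD_comm hU (dirDs_contDiffOn hU hf L) w v
  | trans _ _ ih₁ ih₂ => exact ih₁.trans ih₂

lemma dirDs_append_singleton (L : List E) (v : E) : dirDs (L ++ [v]) f = dirDs L (dirD v f) := by
  simp [dirDs]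

end Derivatives

section Moderate

variable {n p : ℕ} {Ω : Set (Euc n)}

/-- The coordinate directions of `ℝ^n × ℝ^p`. -/
def coordDir : Fin n ⊕ Fin p → Euc n × Euc p := Sum.elim eY eXi

/-- The drop in homogeneity caused by a derivative in a coordinate direction. -/
def coordWt : Fin n ⊕ Fin p → ℝ := Sum.elim 0 1

/-- The net is smooth on `Ω × (ℝ^p ∖ 0)`. -/
def SmoothNet (Ω : Set (Euc n)) (a : ℝ → Euc n × Euc p → ℝ) : Prop :=
  ∀ ε ∈ Set.Ioc (0 : ℝ) 1, ContDiffOn ℝ (⊤ : ℕ∞) (a ε) (punctured p Ω)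

/-- Moderate growth of order `m`, locally uniformly in `y`, of the net itself. -/
def ModBound (Ω : Set (Euc n)) (m : ℝ) (a : ℝ → Euc n × Euc p → ℝ) : Prop :=
  ∀ K ⊆ Ω, IsCompact K → ∃ N : ℕ, ∃ C > 0, ∃ η ∈ Set.Ioc (0 : ℝ) 1,
    ∀ ε ∈ Set.Ioc (0 : ℝ) η, ∀ y ∈ K, ∀ ξ : Euc p, ξ ≠ 0 →
      |a ε (y, ξ)| ≤ C * ε ^ (-(N : ℤ)) * ‖ξ‖ ^ m

/-- Moderate growth of all derivatives up to order `k`, in arbitrary order of differentiation. -/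
def ModUpTo (Ω : Set (Euc n)) : ℕ → ℝ → (ℝ → Euc n × Euc p → ℝ) → Prop
  | 0, m, a => ModBound Ω m a
  | k + 1, m, a => ModBound Ω m a ∧
      ∀ l, ModUpTo Ω k (m - coordWt l) (fun ε => dirD (coordDir l) (a ε))

variable {a b : ℝ → Euc n × Euc p → ℝ} {m m₁ m₂ : ℝ} {k : ℕ}

lemma SmoothNet.dirD (hΩ : IsOpen Ω) (ha : SmoothNet Ω a) (v : Euc n × Euc p) :
    SmoothNet Ω (fun ε => dirD v (a ε)) :=
  fun ε hε => dirD_contDiffOn (isOpen_punctured hΩ) (ha ε hε) v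

lemma SmoothNet.mul (ha : SmoothNet Ω a) (hb : SmoothNet Ω b) :
    SmoothNet Ω (fun ε z => a ε z * b ε z) := fun ε hε => (ha ε hε).mul (hb ε hε)

lemma SmoothNet.add (ha : SmoothNet Ω a) (hb : SmoothNet Ω b) :
    SmoothNet Ω (fun ε z => a ε z + b ε z) := fun ε hε => (ha ε hε).add (hb ε hε)

lemma SmoothNet.sum {ι : Type*} {s : Finset ι} {a : ι → ℝ → Euc n × Euc p → ℝ}
    (ha : ∀ i ∈ s, SmoothNet Ω (a i)) : SmoothNet Ω (fun ε z => ∑ i ∈ s, a i ε z) :=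
  fun ε hε => ContDiffOn.sum fun i hi => ha i hi ε hε

lemma ModBound.congr (h : ∀ ε ∈ Set.Ioc (0 : ℝ) 1, EqOn (a ε) (b ε) (punctured p Ω))
    (ha : ModBound Ω m a) : ModBound Ω m b := by
  intro K hK hKc
  obtain ⟨N, C, hC, η, hη, H⟩ := ha K hK hKc
  refine ⟨N, C, hC, η, hη, fun ε hε y hy ξ hξ => ?_⟩
  rw [← h ε ⟨hε.1, hε.2.trans hη.2⟩ (⟨hK hy, hξ⟩ : (y, ξ) ∈ punctured p Ω)]
  exact H ε hε y hy ξ hξ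

lemma ModBound.mul (ha : ModBound Ω m₁ a) (hb : ModBound Ω m₂ b) :
    ModBound Ω (m₁ + m₂) (fun ε z => a ε z * b ε z) := by
  intro K hK hKc
  obtain ⟨N, C, hC, η, hη, H⟩ := ha K hK hKc
  obtain ⟨N', C', hC', η', hη', H'⟩ := hb K hK hKc
  refine ⟨N + N', C * C', mul_pos hC hC', min η η', ⟨lt_min hη.1 hη'.1, min_le_of_left_le hη.2⟩,
    fun ε hε y hy ξ hξ => ?_⟩
  have hε0 : ε ≠ 0 := hε.1.ne'
  have h₁ := H ε ⟨hε.1, hε.2.trans (min_le_left _ _)⟩ y hy ξ hξ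
  have h₂ := H' ε ⟨hε.1, hε.2.trans (min_le_right _ _)⟩ y hy ξ hξ
  have hexp : -((N + N' : ℕ) : ℤ) = -(N : ℤ) + -(N' : ℤ) := by push_cast; ring
  rw [abs_mul, hexp, zpow_add₀ hε0, Real.rpow_add (norm_pos_iff.2 hξ)]
  calc _ ≤ _ := mul_le_mul h₁ h₂ (abs_nonneg _) ((abs_nonneg _).trans h₁)
    _ = _ := by ring

lemma ModBound.add (ha : ModBound Ω m a) (hb : ModBound Ω m b) :
    ModBound Ω m (fun ε z => a ε z + b ε z) := by
  intro K hK hKc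
  obtain ⟨N, C, hC, η, hη, H⟩ := ha K hK hKc
  obtain ⟨N', C', hC', η', hη', H'⟩ := hb K hK hKc
  refine ⟨N + N', C + C', add_pos hC hC', min η η', ⟨lt_min hη.1 hη'.1, min_le_of_left_le hη.2⟩,
    fun ε hε y hy ξ hξ => ?_⟩
  have hε1 : ε ≤ 1 := hε.2.trans ((min_le_left _ _).trans hη.2)
  have h₁ := H ε ⟨hε.1, hε.2.trans (min_le_left _ _)⟩ y hy ξ hξ
  have h₂ := H' ε ⟨hε.1, hε.2.trans (min_le_right _ _)⟩ y hy ξ hξ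
  have hN : ε ^ (-(N : ℤ)) ≤ ε ^ (-((N + N' : ℕ) : ℤ)) :=
    zpow_le_zpow_right_of_le_one₀ hε.1 hε1 (by push_cast; linarith)
  have hN' : ε ^ (-(N' : ℤ)) ≤ ε ^ (-((N + N' : ℕ) : ℤ)) :=
    zpow_le_zpow_right_of_le_one₀ hε.1 hε1 (by push_cast; linarith)
  calc _ ≤ _ := abs_add_le _ _
    _ ≤ _ := add_le_add h₁ h₂
    _ ≤ C * ε ^ (-((N + N' : ℕ) : ℤ)) * ‖ξ‖ ^ m + C' * ε ^ (-((N + N' : ℕ) : ℤ)) * ‖ξ‖ ^ m := by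
      gcongr
    _ = _ := by ring

lemma ModBound.of_abs_le {C : ℝ} (h : ∀ ε y ξ, ξ ≠ 0 → |a ε (y, ξ)| ≤ C * ‖ξ‖ ^ m) :
    ModBound Ω m a := by
  intro K _ _
  refine ⟨0, |C| + 1, by positivity, 1, by simp, fun ε _ y _ ξ hξ => (h ε y ξ hξ).trans ?_⟩
  have : C ≤ |C| + 1 := (le_abs_self C).trans (by linarith)
  simpa using mul_le_mul_of_nonneg_right this (Real.rpow_nonneg (norm_nonneg ξ) m)

lemma ModUpTo.bound (ha : ModUpTo Ω k m a) : ModBound Ω m a := by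
  cases k with
  | zero => exact ha
  | succ k => exact ha.1

lemma ModUpTo.congr (hΩ : IsOpen Ω)
    (h : ∀ ε ∈ Set.Ioc (0 : ℝ) 1, EqOn (a ε) (b ε) (punctured p Ω))
    (ha : ModUpTo Ω k m a) : ModUpTo Ω k m b := by
  induction k generalizing a b m with
  | zero => exact ModBound.congr h ha
  | succ k ih =>
    exact ⟨ha.1.congr h, fun l =>
      ih (fun ε hε => dirD_congr (isOpen_punctured hΩ) (h ε hε) _) (ha.2 l)⟩

lemma ModUpTo.of_succ (ha : ModUpTo Ω (k + 1) m a) : ModUpTo Ω k m a := by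
  induction k generalizing a m with
  | zero => exact ha.1
  | succ k ih => exact ⟨ha.1, fun l => ih (ha.2 l)⟩

lemma ModUpTo.add (hΩ : IsOpen Ω) (has : SmoothNet Ω a) (hbs : SmoothNet Ω b)
    (ha : ModUpTo Ω k m a) (hb : ModUpTo Ω k m b) :
    ModUpTo Ω k m (fun ε z => a ε z + b ε z) := by
  induction k generalizing a b m with
  | zero => exact ModBound.add ha hb
  | succ k ih =>
    refine ⟨ha.1.add hb.1, fun l => ?_⟩
    refine (ih (has.dirD hΩ _) (hbs.dirD hΩ _) (ha.2 l) (hb.2 l)).congr hΩ fun ε hε z hz => ?_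
    have hU := isOpen_punctured (p := p) hΩ
    simp only [_root_.dirD]
    rw [fderiv_fun_add ((has ε hε).differentiableAt_of_isOpen hU hz)
      ((hbs ε hε).differentiableAt_of_isOpen hU hz)]
    rfl

lemma ModUpTo.mul (hΩ : IsOpen Ω) (has : SmoothNet Ω a) (hbs : SmoothNet Ω b)
    (ha : ModUpTo Ω k m₁ a) (hb : ModUpTo Ω k m₂ b) :
    ModUpTo Ω k (m₁ + m₂) (fun ε z => a ε z * b ε z) := by
  induction k generalizing a b m₁ m₂ with
  | zero => exact ModBound.mul ha hb
  | succ k ih =>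
    refine ⟨ha.1.mul hb.1, fun l => ?_⟩
    have h₁ := ih has (hbs.dirD hΩ _) ha.of_succ (hb.2 l)
    have h₂ := ih (has.dirD hΩ _) hbs (ha.2 l) hb.of_succ
    rw [show m₁ + (m₂ - coordWt l) = m₁ + m₂ - coordWt l by ring] at h₁
    rw [show m₁ - coordWt l + m₂ = m₁ + m₂ - coordWt l by ring] at h₂
    refine (h₁.add hΩ (has.mul (hbs.dirD hΩ _)) ((has.dirD hΩ _).mul hbs) h₂).congr hΩ
      fun ε hε z hz => ?_
    have hU := isOpen_punctured (p := p) hΩ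
    simp only [_root_.dirD]
    rw [fderiv_fun_mul ((has ε hε).differentiableAt_of_isOpen hU hz)
      ((hbs ε hε).differentiableAt_of_isOpen hU hz)]
    simp [mul_comm]

lemma ModUpTo.const (c : ℝ) : ModUpTo Ω k 0 (fun _ (_ : Euc n × Euc p) => c) ∧
    ∀ m, ModUpTo Ω k m (fun _ (_ : Euc n × Euc p) => (0 : ℝ)) := by
  have hz : ∀ k m, ModUpTo Ω k m (fun _ (_ : Euc n × Euc p) => (0 : ℝ)) := by
    intro k
    induction k with
    | zero => exact fun m => ModBound.of_abs_le (C := 0) (by simp)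
    | succ k ih =>
      refine fun m => ⟨ModBound.of_abs_le (C := 0) (by simp), fun l => ?_⟩
      simpa only [dirD_const] using ih (m - coordWt l)
  refine ⟨?_, hz k⟩
  have hc : ModBound Ω 0 (fun _ (_ : Euc n × Euc p) => c) :=
    ModBound.of_abs_le (C := |c|) (by simp)
  cases k with
  | zero => exact hc
  | succ k => exact ⟨hc, fun l => by simpa only [dirD_const] using hz k _⟩

lemma ModUpTo.sum (hΩ : IsOpen Ω) {ι : Type*} {s : Finset ι} {a : ι → ℝ → Euc n × Euc p → ℝ}
    (has : ∀ i ∈ s, SmoothNet Ω (a i)) (ha : ∀ i ∈ s, ModUpTo Ω k m (a i)) :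
    ModUpTo Ω k m (fun ε z => ∑ i ∈ s, a i ε z) := by
  classical
  induction s using Finset.induction_on with
  | empty => simpa using (ModUpTo.const 0).2 m
  | insert i s hi ih =>
    simp only [Finset.sum_insert hi]
    exact ModUpTo.add hΩ (has i (by simp))
      (SmoothNet.sum fun j hj => has j (by simp [hj])) (ha i (by simp))
      (ih (fun j hj => has j (by simp [hj])) fun j hj => ha j (by simp [hj]))

lemma SmoothNet.inv (has : SmoothNet Ω a)
    (h0 : ∀ ε ∈ Set.Ioc (0 : ℝ) 1, ∀ z ∈ punctured p Ω, a ε z ≠ 0) :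
    SmoothNet Ω (fun ε z => (a ε z)⁻¹) := fun ε hε => (has ε hε).inv (h0 ε hε)

lemma ModUpTo.inv (hΩ : IsOpen Ω) (has : SmoothNet Ω a)
    (h0 : ∀ ε ∈ Set.Ioc (0 : ℝ) 1, ∀ z ∈ punctured p Ω, a ε z ≠ 0)
    (ha : ∀ k, ModUpTo Ω k m a) (hb : ModBound Ω (-m) (fun ε z => (a ε z)⁻¹)) :
    ModUpTo Ω k (-m) (fun ε z => (a ε z)⁻¹) := by
  induction k with
  | zero => exact hb
  | succ k ih =>
    refine ⟨hb, fun l => ?_⟩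
    have his := has.inv h0
    have hc : SmoothNet Ω (fun _ (_ : Euc n × Euc p) => (-1 : ℝ)) := fun _ _ => contDiffOn_const
    have key := (((ModUpTo.const (-1)).1.mul hΩ hc (has.dirD hΩ _) ((ha (k + 1)).2 l)).mul hΩ
      (hc.mul (has.dirD hΩ _)) (his.mul his) (ih.mul hΩ his his ih))
    rw [show 0 + (m - coordWt l) + (-m + -m) = -m - coordWt l by ring] at key
    refine key.congr hΩ fun ε hε z hz => ?_
    simp only [_root_.dirD]
    have hd := (has ε hε).differentiableAt_of_isOpen (isOpen_punctured hΩ) hz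
    have hinv : HasFDerivAt (fun w => (a ε w)⁻¹) (-(a ε z ^ 2)⁻¹ • fderiv ℝ (a ε) z) z :=
      (hasDerivAt_inv (h0 ε hε z hz)).comp_hasFDerivAt z hd.hasFDerivAt
    rw [hinv.fderiv]
    simp only [smul_apply, smul_eq_mul]
    field_simp

lemma ModBound.of_hgModerate (h : HgModerate Ω m a) : ModBound Ω m a := by
  intro K hK hKc
  obtain ⟨N, C, hC, η, hη, H⟩ := h K hK hKc [] []
  refine ⟨N, C, hC, η, hη, fun ε hε y hy ξ hξ => ?_⟩
  have := H ε hε y hy ξ hξ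
  simp only [List.length_nil, Nat.cast_zero, add_zero, List.map_nil, List.append_nil, dirDs,
    List.foldr_nil, Real.norm_eq_abs] at this
  rwa [Real.rpow_neg (norm_nonneg _), inv_mul_le_iff₀
    (Real.rpow_pos_of_pos (norm_pos_iff.2 hξ) _), mul_comm] at this

lemma HgModerate.dirD (hΩ : IsOpen Ω) (has : SmoothNet Ω a) (h : HgModerate Ω m a)
    (l : Fin n ⊕ Fin p) : HgModerate Ω (m - coordWt l) (fun ε => dirD (coordDir l) (a ε)) := by
  intro K hK hKc α β
  rcases l with i | j
  · obtain ⟨N, C, hC, η, hη, H⟩ := h K hK hKc α (β ++ [i])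
    refine ⟨N, C, hC, η, hη, fun ε hε y hy ξ hξ => ?_⟩
    have := H ε hε y hy ξ hξ
    rw [List.map_append, List.map_singleton, ← List.append_assoc, dirDs_append_singleton] at this
    simpa [coordWt, coordDir] using this
  · obtain ⟨N, C, hC, η, hη, H⟩ := h K hK hKc (α ++ [j]) β
    refine ⟨N, C, hC, η, hη, fun ε hε y hy ξ hξ => ?_⟩
    have := H ε hε y hy ξ hξ
    have hp : ((α ++ [j]).map eXi ++ β.map eY : List (Euc n × Euc p)).Perm
        ((α.map eXi ++ β.map eY) ++ [eXi j]) := by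
      simp only [List.map_append, List.map_singleton, List.append_assoc]
      exact List.Perm.append_left _ List.perm_append_comm
    rw [dirDs_perm (isOpen_punctured hΩ) (has ε ⟨hε.1, hε.2.trans hη.2⟩) hp
      (⟨hK hy, hξ⟩ : (y, ξ) ∈ punctured p Ω), dirDs_append_singleton] at this
    have hexp : -m + ((α ++ [j]).length : ℝ) = -(m - 1) + (α.length : ℝ) := by
      simp; ring
    rw [hexp] at this
    simpa [coordWt, coordDir] using this

lemma ModUpTo.of_hgModerate (hΩ : IsOpen Ω) (has : SmoothNet Ω a) (h : HgModerate Ω m a) :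
    ModUpTo Ω k m a := by
  induction k generalizing a m with
  | zero => exact ModBound.of_hgModerate h
  | succ k ih =>
    exact ⟨ModBound.of_hgModerate h, fun l => ih (has.dirD hΩ _) (h.dirD hΩ has l)⟩

lemma ModUpTo.dirDs_eY {β : List (Fin n)} (h : ModUpTo Ω (k + β.length) m a) :
    ModUpTo Ω k m (fun ε => dirDs (β.map eY) (a ε)) := by
  induction β generalizing k with
  | nil => exact h
  | cons i β ih =>
    have h' : ModUpTo Ω (k + 1 + β.length) m a := by
      rwa [List.length_cons, ← add_assoc, add_right_comm] at h
    have := (ih h').2 (Sum.inl i)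
    rwa [show m - coordWt (Sum.inl i : Fin n ⊕ Fin p) = m by simp [coordWt]] at this

lemma ModUpTo.dirDs_eXi {α : List (Fin p)} (h : ModUpTo Ω (k + α.length) m a) :
    ModUpTo Ω k (m - α.length) (fun ε => dirDs (α.map eXi) (a ε)) := by
  induction α generalizing k with
  | nil =>
    rw [List.length_nil, Nat.cast_zero, sub_zero]
    exact h
  | cons j α ih =>
    have h' : ModUpTo Ω (k + 1 + α.length) m a := by
      rwa [List.length_cons, ← add_assoc, add_right_comm] at h
    have := (ih h').2 (Sum.inr j)
    rw [show m - (α.length : ℝ) - coordWt (Sum.inr j : Fin n ⊕ Fin p) =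
      m - ((j :: α).length : ℝ) by simp [coordWt]; ring] at this
    exact this

lemma HgModerate.of_modUpTo (h : ∀ k, ModUpTo Ω k m a) : HgModerate Ω m a := by
  intro K hK hKc α β
  have key := (ModUpTo.dirDs_eXi (k := 0) (α := α)
    (ModUpTo.dirDs_eY (β := β) (h (0 + α.length + β.length)))).bound
  obtain ⟨N, C, hC, η, hη, H⟩ := key K hK hKc
  refine ⟨N, C, hC, η, hη, fun ε hε y hy ξ hξ => ?_⟩
  have := H ε hε y hy ξ hξ
  rw [show -m + (α.length : ℝ) = -(m - α.length) by ring, Real.rpow_neg (norm_nonneg _),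
    inv_mul_le_iff₀ (Real.rpow_pos_of_pos (norm_pos_iff.2 hξ) _), mul_comm]
  simpa [dirDs, List.foldr_append] using this

lemma coord_smoothNet (j : Fin p) : SmoothNet Ω (fun _ (z : Euc n × Euc p) => z.2 j) :=
  fun _ _ => ContDiff.contDiffOn (by fun_prop)

lemma coord_modUpTo (j : Fin p) : ModUpTo Ω k 1 (fun _ (z : Euc n × Euc p) => z.2 j) := by
  have hb : ModBound Ω 1 (fun _ (z : Euc n × Euc p) => z.2 j) :=
    ModBound.of_abs_le (C := 1) fun _ _ ξ _ => by
      simpa using PiLp.norm_apply_le ξ j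
  cases k with
  | zero => exact hb
  | succ k =>
    have hd : ∀ v : Euc n × Euc p,
        dirD v (fun z : Euc n × Euc p => z.2 j) = fun _ => v.2 j := by
      intro v
      funext z
      exact congrArg (fun L => L v) (((EuclideanSpace.proj j : Euc p →L[ℝ] ℝ).comp
        (ContinuousLinearMap.snd ℝ (Euc n) (Euc p))).fderiv (x := z))
    refine ⟨hb, fun l => ?_⟩
    simp only [hd]
    rcases l with i | i
    · simpa [coordDir, eY] using (ModUpTo.const 0).2 _
    · simpa [coordWt] using (ModUpTo.const _).1

lemma invNormSq_smoothNet_modUpTo (hΩ : IsOpen Ω) :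
    SmoothNet Ω (fun _ (z : Euc n × Euc p) => (‖z.2‖ ^ 2)⁻¹) ∧
      ∀ k, ModUpTo Ω k (-2) (fun _ (z : Euc n × Euc p) => (‖z.2‖ ^ 2)⁻¹) := by
  have hs : ∀ j : Fin p, SmoothNet Ω (fun _ (z : Euc n × Euc p) => z.2 j * z.2 j) :=
    fun j => (coord_smoothNet j).mul (coord_smoothNet j)
  have heq : ∀ z : Euc n × Euc p, ‖z.2‖ ^ 2 = ∑ j, z.2 j * z.2 j := by
    intro z
    rw [EuclideanSpace.real_norm_sq_eq]
    exact Finset.sum_congr rfl fun _ _ => sq _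
  have hsm : SmoothNet Ω (fun _ (z : Euc n × Euc p) => ‖z.2‖ ^ 2) := by
    simp only [heq]
    exact SmoothNet.sum fun j _ => hs j
  have hmod : ∀ k, ModUpTo Ω k 2 (fun _ (z : Euc n × Euc p) => ‖z.2‖ ^ 2) := by
    intro k
    simp only [heq]
    refine ModUpTo.sum hΩ (fun j _ => hs j) fun j _ => ?_
    have := (coord_modUpTo (Ω := Ω) (k := k) j).mul hΩ (coord_smoothNet j) (coord_smoothNet j)
      (coord_modUpTo j)
    rwa [one_add_one_eq_two] at this
  have h0 : ∀ ε ∈ Set.Ioc (0 : ℝ) 1, ∀ z ∈ punctured p Ω, ‖z.2‖ ^ 2 ≠ 0 :=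
    fun _ _ z hz => pow_ne_zero 2 (norm_ne_zero_iff.2 hz.2)
  refine ⟨hsm.inv h0, fun k => ModUpTo.inv hΩ hsm h0 hmod ?_⟩
  refine ModBound.of_abs_le (C := 1) fun _ _ ξ _ => ?_
  rw [Real.rpow_neg (norm_nonneg _), abs_of_nonneg (by positivity)]
  simp

end Moderate

section Homogeneous

variable {n p : ℕ} {Ω : Set (Euc n)} {f : Euc n × Euc p → ℝ}

lemma fderiv_homogeneous (hΩ : IsOpen Ω) (hf : ContDiffOn ℝ (⊤ : ℕ∞) f (punctured p Ω))
    {t : ℝ} (ht : 0 < t)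
    (hom : ∀ y ∈ Ω, ∀ ξ : Euc p, ξ ≠ 0 → f (y, t • ξ) = t * f (y, ξ))
    {z : Euc n × Euc p} (hz : z ∈ punctured p Ω) (v : Euc n × Euc p) :
    fderiv ℝ f (z.1, t • z.2) (v.1, t • v.2) = t * fderiv ℝ f z v := by
  have hU := isOpen_punctured (p := p) hΩ
  let T : (Euc n × Euc p) →L[ℝ] Euc n × Euc p :=
    (ContinuousLinearMap.id ℝ (Euc n)).prodMap (t • ContinuousLinearMap.id ℝ (Euc p))
  have hTz : T z ∈ punctured p Ω := ⟨hz.1, smul_ne_zero ht.ne' hz.2⟩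
  have h₁ : HasFDerivAt (f ∘ T) ((fderiv ℝ f (T z)).comp T) z :=
    (hf.differentiableAt_of_isOpen hU hTz).hasFDerivAt.comp z T.hasFDerivAt
  have h₂ : HasFDerivAt (fun w => t * f w) (t • fderiv ℝ f z) z :=
    (hf.differentiableAt_of_isOpen hU hz).hasFDerivAt.const_mul t
  have heq : (fun w => t * f w) =ᶠ[𝓝 z] f ∘ T := by
    filter_upwards [hU.mem_nhds hz] with w hw
    exact (hom w.1 hw.1 w.2 hw.2).symm
  exact congrArg (fun L => L v) ((h₂.congr_of_eventuallyEq heq.symm).unique h₁).symm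

lemma gradSq_normalize (hΩ : IsOpen Ω) (hf : ContDiffOn ℝ (⊤ : ℕ∞) f (punctured p Ω))
    (hom : ∀ y ∈ Ω, ∀ ξ : Euc p, ξ ≠ 0 → ∀ t : ℝ, 0 < t → f (y, t • ξ) = t * f (y, ξ))
    {z : Euc n × Euc p} (hz : z ∈ punctured p Ω) :
    gradSq f (z.1, ‖z.2‖⁻¹ • z.2) =
      (∑ k, (‖z.2‖ ^ 2)⁻¹ * (dirD (eY k) f z * dirD (eY k) f z)) +
        ∑ j, dirD (eXi j) f z * dirD (eXi j) f z := by
  have ht : 0 < ‖z.2‖⁻¹ := inv_pos.2 (norm_pos_iff.2 hz.2)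
  have key := fderiv_homogeneous hΩ hf ht (fun y hy ξ hξ => hom y hy ξ hξ _ ht) hz
  unfold gradSq
  congr 1
  · refine Finset.sum_congr rfl fun k _ => ?_
    have := key (eY k)
    simp only [eY, smul_zero] at this
    simp only [dirD, eY, this]
    ring
  · refine Finset.sum_congr rfl fun j _ => ?_
    have := key (eXi j)
    have hv : ((eXi j : Euc n × Euc p).1, ‖z.2‖⁻¹ • (eXi j : Euc n × Euc p).2) =
        ‖z.2‖⁻¹ • (eXi j : Euc n × Euc p) := by simp [eXi]
    rw [hv, map_smul, smul_eq_mul] at this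
    simp only [dirD, mul_left_cancel₀ ht.ne' this]
    ring

end Homogeneous

/-- Lemma on φ_{φ_ε} = |∇_{y,ξ}φ_ε(y,ξ/|ξ|)|⁻²: smooth on Ω×(ℝ^p∖0),
homogeneous of degree 0 in ξ, and a moderate net in S^0_hg(Ω×ℝ^p∖0). -/
theorem stmt2 {n p : ℕ} (Ω : Set (Euc n)) (hΩ : IsOpen Ω)
    (φ : ℝ → Euc n × Euc p → ℝ) (hφ : MPhi Ω φ) :
    (∀ ε ∈ Set.Ioc (0:ℝ) 1,
      ContDiffOn ℝ (⊤ : ℕ∞) (fun z => varphiN (φ ε) z) (Ω ×ˢ {ξ : Euc p | ξ ≠ 0}) ∧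
      (∀ y ∈ Ω, ∀ ξ : Euc p, ξ ≠ 0 → ∀ t : ℝ, 0 < t →
        varphiN (φ ε) (y, t • ξ) = varphiN (φ ε) (y, ξ))) ∧
    HgModerate Ω 0 (fun ε => varphiN (φ ε)) := by
  obtain ⟨hphase, hmod, hlow⟩ := hφ
  have hs : SmoothNet Ω φ := fun ε hε => (hphase ε hε).1
  obtain ⟨hrs, hrm⟩ := invNormSq_smoothNet_modUpTo (n := n) (p := p) hΩ
  have hm : ∀ k, ModUpTo Ω k 1 φ := fun k => ModUpTo.of_hgModerate hΩ hs hmod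
  let g : ℝ → Euc n × Euc p → ℝ := fun ε z =>
    (∑ k, (‖z.2‖ ^ 2)⁻¹ * (dirD (eY k) (φ ε) z * dirD (eY k) (φ ε) z)) +
      ∑ j, dirD (eXi j) (φ ε) z * dirD (eXi j) (φ ε) z
  have hg : ∀ ε ∈ Set.Ioc (0:ℝ) 1, ∀ z ∈ punctured p Ω,
      gradSq (φ ε) (z.1, ‖z.2‖⁻¹ • z.2) = g ε z := fun ε hε z hz =>
    gradSq_normalize hΩ (hs ε hε) (hphase ε hε).2.1 hz
  have hYs : ∀ i : Fin n, SmoothNet Ω (fun ε => dirD (eY i) (φ ε)) := fun i => hs.dirD hΩ _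
  have hXs : ∀ j : Fin p, SmoothNet Ω (fun ε => dirD (eXi j) (φ ε)) := fun j => hs.dirD hΩ _
  have hYm : ∀ k, ∀ i : Fin n, ModUpTo Ω k 1 (fun ε => dirD (eY i) (φ ε)) := fun k i => by
    simpa [coordWt, coordDir] using (hm (k + 1)).2 (Sum.inl i)
  have hXm : ∀ k, ∀ j : Fin p, ModUpTo Ω k 0 (fun ε => dirD (eXi j) (φ ε)) := fun k j => by
    simpa [coordWt, coordDir] using (hm (k + 1)).2 (Sum.inr j)
  have hYs2 := fun i => hrs.mul ((hYs i).mul (hYs i))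
  have hXs2 := fun j => (hXs j).mul (hXs j)
  have hgs : SmoothNet Ω g :=
    (SmoothNet.sum fun i _ => hYs2 i).add (SmoothNet.sum fun j _ => hXs2 j)
  have hgm : ∀ k, ModUpTo Ω k 0 g := by
    refine fun k => ModUpTo.add hΩ (SmoothNet.sum fun i _ => hYs2 i)
      (SmoothNet.sum fun j _ => hXs2 j) (ModUpTo.sum hΩ (fun i _ => hYs2 i) fun i _ => ?_)
      (ModUpTo.sum hΩ (fun j _ => hXs2 j) fun j _ => ?_)
    · have := (hrm k).mul hΩ hrs ((hYs i).mul (hYs i))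
        ((hYm k i).mul hΩ (hYs i) (hYs i) (hYm k i))
      rwa [show (-2 : ℝ) + (1 + 1) = 0 by norm_num] at this
    · have := (hXm k j).mul hΩ (hXs j) (hXs j) (hXm k j)
      rwa [add_zero] at this
  have hg0 : ∀ ε ∈ Set.Ioc (0:ℝ) 1, ∀ z ∈ punctured p Ω, g ε z ≠ 0 := fun ε hε z hz => by
    rw [← hg ε hε z hz]
    exact (hphase ε hε).2.2 z.1 hz.1 _
      (smul_ne_zero (inv_ne_zero (norm_ne_zero_iff.2 hz.2)) hz.2)
  have hEq : ∀ ε ∈ Set.Ioc (0:ℝ) 1,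
      EqOn (fun z => (g ε z)⁻¹) (varphiN (φ ε)) (punctured p Ω) := fun ε hε z hz => by
    simp only [varphiN, hg ε hε z hz]
  have hbound : ModBound Ω (-0) (fun ε z => (g ε z)⁻¹) := by
    intro K hK hKc
    obtain ⟨r, -, η, hη, H⟩ := hlow K hK hKc
    refine ⟨⌈r⌉₊, 1, one_pos, η, hη, fun ε hε y hy ξ hξ => ?_⟩
    have hε1 : ε ≤ 1 := hε.2.trans hη.2
    have hle := H ε hε y hy ξ hξ
    rw [hg ε ⟨hε.1, hε1⟩ (y, ξ) ⟨hK hy, hξ⟩] at hle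
    have hpos : 0 < ε ^ r := Real.rpow_pos_of_pos hε.1 r
    have hpow : ε ^ ⌈r⌉₊ ≤ ε ^ r := by
      rw [← Real.rpow_natCast]
      exact Real.rpow_le_rpow_of_exponent_ge hε.1 hε1 (Nat.le_ceil r)
    rw [abs_of_pos (inv_pos.2 (hpos.trans_le hle)), neg_zero, Real.rpow_zero, one_mul, mul_one,
      zpow_neg, zpow_natCast]
    exact inv_anti₀ (pow_pos hε.1 _) (hpow.trans hle)
  refine ⟨fun ε hε => ⟨?_, fun y _ ξ _ t ht => ?_⟩, HgModerate.of_modUpTo fun k => ?_⟩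
  · exact (hgs.inv hg0 ε hε).congr fun z hz => (hEq ε hε hz).symm
  · have : ‖t • ξ‖⁻¹ • t • ξ = ‖ξ‖⁻¹ • ξ := by
      rw [norm_smul, Real.norm_of_nonneg ht.le, smul_smul]
      congr 1
      field_simp
    simp only [varphiN, this]
  · have := (ModUpTo.inv (k := k) hΩ hgs hg0 hgm hbound).congr hΩ hEq
    rwa [neg_zero] at this
end
end
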